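/- A function p_{θ₁,θ₂} with (θ₁,θ₂) ∈ Θ and θ₂ < 0 is the worst case localiser q̂_k for k ∈ (0, k_max) if and only if the vector (1 − ∫ p_{θ₁,θ₂} dμ, V(k) − ∫ X p_{θ₁,θ₂} dμ) ∈ ℝ² belongs to the normal cone of dom K at (θ₁,θ₂), i.e., for every (θ̄₁,θ̄₂) ∈ dom K it holds that (θ̄₁ − θ₁)(1 − ∫ p_{θ₁,θ₂} dμ) + (θ̄₂ − θ₂)(V(k) − ∫ X p_{θ₁,θ₂} dμ) ≤ 0. -/

import Mathlib

open MeasureTheory Filter Set Topology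
open scoped ENNReal

noncomputable section

variable {Ω : Type*} [MeasurableSpace Ω]

/-- The positive part of an extended real number, as a member of `ℝ≥0∞`. -/
def ePos (x : EReal) : ℝ≥0∞ := if x = ⊤ then ⊤ else ENNReal.ofReal x.toReal

/-- The (signed) integral of an extended-real-valued function: the integral of its
positive part minus the integral of its negative part. -/
def eInt (μ : Measure Ω) (f : Ω → EReal) : EReal :=
  ((∫⁻ r, ePos (f r) ∂μ : ℝ≥0∞) : EReal) - ((∫⁻ r, ePos (-(f r)) ∂μ : ℝ≥0∞) : EReal)

/-- `p` is a probability density with respect to `μ`. -/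
def IsDensity (μ : Measure Ω) (p : Ω → ℝ) : Prop :=
  Measurable p ∧ (∀ r, 0 ≤ p r) ∧ ∫⁻ r, ENNReal.ofReal (p r) ∂μ = 1

/-- `∫ p dμ` for a nonnegative function `p`. -/
def pInt (μ : Measure Ω) (p : Ω → ℝ) : ℝ≥0∞ := ∫⁻ r, ENNReal.ofReal (p r) ∂μ

/-- The convex integral functional `H(p) = ∫ β(r, p(r)) μ(dr)`. -/
def Hfun (μ : Measure Ω) (β : Ω → ℝ → EReal) (p : Ω → ℝ) : EReal :=
  eInt μ (fun r => β r (p r))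

/-- The expected payoff `∫ X p dμ`, as an extended real number. -/
def xInt (μ : Measure Ω) (X p : Ω → ℝ) : EReal :=
  eInt μ (fun r => ((X r * p r : ℝ) : EReal))

/-- The value function `F(b) = inf { H(p) : p density, ∫ X p dμ = b }`. -/
def Ffun (μ : Measure Ω) (β : Ω → ℝ → EReal) (X : Ω → ℝ) (b : ℝ) : EReal :=
  ⨅ p : {p : Ω → ℝ // IsDensity μ p ∧ xInt μ X p = (b : EReal)}, Hfun μ β p.1

/-- The essential infimum `m` of `X`, as an extended real number. -/
def essInfX (μ : Measure Ω) (X : Ω → ℝ) : EReal := essInf (fun r => (X r : EReal)) μ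

/-- The essential supremum `M` of `X`, as an extended real number. -/
def essSupX (μ : Measure Ω) (X : Ω → ℝ) : EReal := essSup (fun r => (X r : EReal)) μ

/-- `k_max = lim_{b ↓ m} F(b)`; since `F` is nonincreasing on `(m, b₀)`, this limit
equals the supremum of `F` over `(m, b₀)`. -/
def kmax (μ : Measure Ω) (β : Ω → ℝ → EReal) (X : Ω → ℝ) (b₀ : ℝ) : EReal :=
  ⨆ b : {b : ℝ // essInfX μ X < (b : EReal) ∧ b < b₀}, Ffun μ β X b

/-- `V(k) = inf { ∫ X p dμ : p density, H(p) ≤ k }`. -/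
def Vfun (μ : Measure Ω) (β : Ω → ℝ → EReal) (X : Ω → ℝ) (k : ℝ) : EReal :=
  ⨅ p : {p : Ω → ℝ // IsDensity μ p ∧ Hfun μ β p ≤ (k : EReal)}, xInt μ X p.1

/-- `W(λ) = inf { ∫ X p dμ + λ H(p) : p density }`. -/
def Wfun (μ : Measure Ω) (β : Ω → ℝ → EReal) (X : Ω → ℝ) (lam : ℝ) : EReal :=
  ⨅ p : {p : Ω → ℝ // IsDensity μ p}, (xInt μ X p.1 + (lam : EReal) * Hfun μ β p.1)

/-- The convex conjugate `β*(r, τ) = sup_s (sτ − β(r,s))` of `β` in its second variable. -/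
def conjβ (β : Ω → ℝ → EReal) (r : Ω) (τ : ℝ) : EReal :=
  ⨆ s : ℝ, (((s * τ : ℝ) : EReal) - β r s)

/-- `K(θ₁, θ₂) = ∫ β*(r, θ₁ + θ₂ X(r)) μ(dr)`. -/
def Kfun (μ : Measure Ω) (β : Ω → ℝ → EReal) (X : Ω → ℝ) (θ₁ θ₂ : ℝ) : EReal :=
  eInt μ (fun r => conjβ β r (θ₁ + θ₂ * X r))

/-- `dom K = {(θ₁, θ₂) : K(θ₁,θ₂) < +∞}`. -/
def domK (μ : Measure Ω) (β : Ω → ℝ → EReal) (X : Ω → ℝ) : Set (ℝ × ℝ) :=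
  {θ : ℝ × ℝ | Kfun μ β X θ.1 θ.2 < ⊤}

/-- `β'(r, +∞) = lim_{s ↑ ∞} β'(r,s)`; by monotonicity of the derivative of a convex
function this equals the supremum of `β'(r, ·)` over `(0, ∞)`. -/
def derivTop (β' : Ω → ℝ → ℝ) (r : Ω) : EReal := ⨆ s : {s : ℝ // 0 < s}, (β' r s.1 : EReal)

/-- `β'(r, 0) = lim_{s ↓ 0} β'(r,s)`, the infimum of `β'(r, ·)` over `(0, ∞)`. -/
def derivZero (β' : Ω → ℝ → ℝ) (r : Ω) : EReal := ⨅ s : {s : ℝ // 0 < s}, (β' r s.1 : EReal)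

/-- The parameter set `Θ`. -/
def ThetaSet (μ : Measure Ω) (β : Ω → ℝ → EReal) (β' : Ω → ℝ → ℝ) (X : Ω → ℝ) :
    Set (ℝ × ℝ) :=
  {θ ∈ domK μ β X | ∀ᵐ r ∂μ, ((θ.1 + θ.2 * X r : ℝ) : EReal) < derivTop β' r}

/-- The generalised exponential family member `p_{θ₁,θ₂}(r) = (β*)'(r, θ₁ + θ₂ X(r))`,
where `ψ` denotes the derivative `(β*)'` of the conjugate in its second variable. -/
def pFam (ψ : Ω → ℝ → ℝ) (X : Ω → ℝ) (θ₁ θ₂ : ℝ) : Ω → ℝ :=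
  fun r => ψ r (θ₁ + θ₂ * X r)

/-- `G(θ₂) = inf_{θ₁} [K(θ₁,θ₂) − θ₁]`. -/
def Gfun (μ : Measure Ω) (β : Ω → ℝ → EReal) (X : Ω → ℝ) (θ₂ : ℝ) : EReal :=
  ⨅ θ₁ : ℝ, (Kfun μ β X θ₁ θ₂ - (θ₁ : EReal))

/-- `Θ₂ = dom G`, the projection of `dom K` to the `θ₂`-axis. -/
def Theta2 (μ : Measure Ω) (β : Ω → ℝ → EReal) (X : Ω → ℝ) : Set ℝ :=
  {θ₂ : ℝ | Gfun μ β X θ₂ < ⊤}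

/-- The Bregman integrand `Δ_β(r, s, t)`; for `t = 0` it is defined as the limit `t ↓ 0`
(with `β'(r,0) = lim_{t↓0} β'(r,t)`), and if `β(r,0) = +∞` then `Δ_β(r,0,0) = 0` and
`Δ_β(r,s,0) = +∞` for `s > 0`. -/
def bregmanInt (β : Ω → ℝ → EReal) (β' : Ω → ℝ → ℝ) (r : Ω) (s t : ℝ) : EReal :=
  if 0 < t then β r s - β r t - ((β' r t : EReal) * ((s - t : ℝ) : EReal))
  else if β r 0 = ⊤ then (if s = 0 then 0 else ⊤)
  else β r s - β r 0 - derivZero β' r * ((s : ℝ) : EReal)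

/-- The (generalised) Bregman distance `B(p, q)`. -/
def Bdist (μ : Measure Ω) (β : Ω → ℝ → EReal) (β' : Ω → ℝ → ℝ) (p q : Ω → ℝ) : EReal :=
  eInt μ (fun r => bregmanInt β β' r (p r) (q r))

/-- The standing assumptions of the framework: `μ` is σ-finite; `β` is a normal convex
integrand (measurable in `r`; equal to `+∞` for `s < 0`; finite, strictly convex and
differentiable with derivative `β'` on `(0,∞)`; right-continuous at `0`); `p₀` is a
density with finite expected payoff `b₀` satisfying `m < b₀ < M`; `H(p₀) = 0 ≤ H(p)`
for every density `p`; and `k_max > 0`. -/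
structure Standing (μ : Measure Ω) (β : Ω → ℝ → EReal) (β' : Ω → ℝ → ℝ)
    (X : Ω → ℝ) (p₀ : Ω → ℝ) (b₀ : ℝ) : Prop where
  sigma : SigmaFinite μ
  betaMeas : ∀ s : ℝ, Measurable (fun r => β r s)
  Xmeas : Measurable X
  betaNeg : ∀ r : Ω, ∀ s : ℝ, s < 0 → β r s = ⊤
  betaNeBot : ∀ r s, β r s ≠ ⊥
  betaFin : ∀ r : Ω, ∀ s : ℝ, 0 < s → β r s ≠ ⊤
  betaZero : ∀ r, Tendsto (fun s => β r s) (𝓝[>] (0:ℝ)) (𝓝 (β r 0))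
  betaConv : ∀ r, StrictConvexOn ℝ (Ioi (0:ℝ)) (fun s => (β r s).toReal)
  betaDeriv : ∀ r : Ω, ∀ s ∈ Ioi (0:ℝ), HasDerivAt (fun t => (β r t).toReal) (β' r s) s
  dens₀ : IsDensity μ p₀
  payoff₀ : xInt μ X p₀ = (b₀ : EReal)
  mlt : essInfX μ X < (b₀ : EReal)
  ltM : (b₀ : EReal) < essSupX μ X
  H₀ : Hfun μ β p₀ = 0
  Hnonneg : ∀ p, IsDensity μ p → 0 ≤ Hfun μ β p
  kmaxPos : 0 < kmax μ β X b₀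

/-- The hypothesis that `ψ = (β*)'`: at every point `τ < β'(r,+∞)`, where the conjugate
`β*(r,·)` is finite and differentiable, `ψ r τ` is its derivative. -/
def IsConjDeriv (β : Ω → ℝ → EReal) (β' : Ω → ℝ → ℝ) (ψ : Ω → ℝ → ℝ) : Prop :=
  ∀ r : Ω, ∀ τ : ℝ, ((τ : ℝ) : EReal) < derivTop β' r →
    HasDerivAt (fun t => (conjβ β r t).toReal) (ψ r τ) τ

/-- `(θ₁, θ₂)` with `θ₂ < 0` attains the double maximum
`max_{θ₂<0} max_{θ₁} (k + K(θ₁,θ₂) − θ₁)/θ₂` (whose value is `V(k)`); such a pair is a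
parameter pair of the worst case localiser `q̂_k = p_{θ₁,θ₂}`. -/
def IsWCLParam (μ : Measure Ω) (β : Ω → ℝ → EReal) (X : Ω → ℝ) (k : ℝ) (θ₁ θ₂ : ℝ) : Prop :=
  θ₂ < 0 ∧ ∀ θ₁' θ₂' : ℝ, θ₂' < 0 →
    ((k : EReal) + Kfun μ β X θ₁' θ₂' - (θ₁' : EReal)) / ((θ₂' : ℝ) : EReal) ≤
      ((k : EReal) + Kfun μ β X θ₁ θ₂ - (θ₁ : EReal)) / ((θ₂ : ℝ) : EReal)

/-- `p` is an (ε-γ)-almost worst case density for threshold `k`. -/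
def AWCD (μ : Measure Ω) (β : Ω → ℝ → EReal) (X : Ω → ℝ) (k ε γ : ℝ) (p : Ω → ℝ) : Prop :=
  IsDensity μ p ∧ Hfun μ β p ≤ ((k + γ : ℝ) : EReal) ∧
    xInt μ X p ≤ Vfun μ β X k + (ε : EReal)

/-- Convergence locally in measure. -/
def TendstoLocallyInMeasure (μ : Measure Ω) (p : ℕ → Ω → ℝ) (q : Ω → ℝ) : Prop :=
  ∀ C : Set Ω, MeasurableSet C → μ C < ⊤ → ∀ ε : ℝ, 0 < ε →
    Tendsto (fun n => μ {r ∈ C | ε < |p n r - q r|}) atTop (𝓝 0)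

end

section ExtendedIntegral

variable {Ω : Type*} [MeasurableSpace Ω] {μ : Measure Ω}

theorem ePos_coe (x : ℝ) : ePos (x : EReal) = ENNReal.ofReal x := by
  simp [ePos]

theorem ePos_neg_coe (x : ℝ) : ePos (-(x : EReal)) = ENNReal.ofReal (-x) := by
  rw [← EReal.coe_neg, ePos_coe]

theorem ePos_mono : Monotone ePos := by
  intro x y h
  by_cases hy : y = ⊤
  · simp [ePos, hy]
  have hx : x ≠ ⊤ := fun hx => hy (top_le_iff.1 (hx ▸ h))
  simp only [ePos, hx, hy, if_false]
  induction x with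
  | bot => simp
  | top => exact absurd rfl hx
  | coe x =>
    exact ENNReal.ofReal_le_ofReal (EReal.toReal_le_toReal h (EReal.coe_ne_bot x) hy)

theorem measurable_ePos : Measurable ePos :=
  Measurable.ite (measurableSet_singleton ⊤) measurable_const
    measurable_ereal_toReal.ennreal_ofReal

theorem eInt_eq_integral {f : Ω → EReal} (hf : ∀ᵐ r ∂μ, f r ≠ ⊤ ∧ f r ≠ ⊥)
    (hi : Integrable (fun r => (f r).toReal) μ) :
    eInt μ f = ((∫ r, (f r).toReal ∂μ : ℝ) : EReal) := by
  have h1 : ∫⁻ r, ePos (f r) ∂μ = ∫⁻ r, ENNReal.ofReal ((f r).toReal) ∂μ := by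
    refine lintegral_congr_ae ?_
    filter_upwards [hf] with r hr
    simp [ePos, hr.1]
  have h2 : ∫⁻ r, ePos (-(f r)) ∂μ = ∫⁻ r, ENNReal.ofReal (-(f r).toReal) ∂μ := by
    refine lintegral_congr_ae ?_
    filter_upwards [hf] with r hr
    simp [ePos, hr.2]
  rw [eInt, h1, h2, integral_eq_lintegral_pos_part_sub_lintegral_neg_part hi, EReal.coe_sub,
    EReal.coe_ennreal_toReal hi.lintegral_lt_top.ne,
    EReal.coe_ennreal_toReal (x := ∫⁻ r, ENNReal.ofReal (-(f r).toReal) ∂μ)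
      hi.neg.lintegral_lt_top.ne]

theorem finite_of_eInt {f : Ω → EReal} (hm : AEMeasurable f μ) (ht : eInt μ f ≠ ⊤)
    (hb : eInt μ f ≠ ⊥) :
    (∀ᵐ r ∂μ, f r ≠ ⊤ ∧ f r ≠ ⊥) ∧ Integrable (fun r => (f r).toReal) μ := by
  have hB : ∫⁻ r, ePos (-(f r)) ∂μ ≠ ⊤ := by
    intro h
    apply hb
    simp [eInt, h]
  have hA : ∫⁻ r, ePos (f r) ∂μ ≠ ⊤ := by
    intro h
    apply ht
    rw [eInt, h]
    lift (∫⁻ r, ePos (-(f r)) ∂μ) to NNReal using hB with B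
    exact EReal.top_sub_coe (B : ℝ)
  have hmA : AEMeasurable (fun r => ePos (f r)) μ := measurable_ePos.comp_aemeasurable hm
  have hmB : AEMeasurable (fun r => ePos (-(f r))) μ := measurable_ePos.comp_aemeasurable hm.neg
  have hfin : ∀ᵐ r ∂μ, f r ≠ ⊤ ∧ f r ≠ ⊥ := by
    filter_upwards [ae_lt_top' hmA hA, ae_lt_top' hmB hB] with r h1 h2
    constructor
    · intro h
      simp [ePos, h] at h1
    · intro h
      simp [ePos, h] at h2
  refine ⟨hfin, measurable_ereal_toReal.comp_aemeasurable hm |>.aestronglyMeasurable, ?_⟩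
  have hle : ∫⁻ r, ‖(f r).toReal‖ₑ ∂μ ≤ ∫⁻ r, (ePos (f r) + ePos (-(f r))) ∂μ := by
    refine lintegral_mono_ae ?_
    filter_upwards [hfin] with r hr
    lift f r to ℝ using hr with x
    rw [ePos_coe, ePos_neg_coe, EReal.toReal_coe, Real.enorm_eq_ofReal_abs]
    rcases le_total 0 x with h | h
    · rw [abs_of_nonneg h]; exact le_self_add
    · rw [abs_of_nonpos h]; exact le_add_self
  refine lt_of_le_of_lt hle ?_
  rw [lintegral_add_left' hmA]
  exact ENNReal.add_lt_top.2 ⟨hA.lt_top, hB.lt_top⟩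

/-- An extended integrand with a real integral is integrable with that integral. -/
theorem integrable_of_eInt_eq_coe {f : Ω → EReal} (hm : AEMeasurable f μ) {x : ℝ}
    (h : eInt μ f = (x : EReal)) :
    (∀ᵐ r ∂μ, f r ≠ ⊤ ∧ f r ≠ ⊥) ∧ Integrable (fun r => (f r).toReal) μ ∧
      ∫ r, (f r).toReal ∂μ = x := by
  obtain ⟨h1, h2⟩ := finite_of_eInt hm (by simp [h]) (by simp [h])
  refine ⟨h1, h2, ?_⟩
  rw [eInt_eq_integral h1 h2] at h
  exact_mod_cast h

/-- An extended integrand with an integrable minorant has an integral different from `⊥`. -/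
theorem eInt_ne_bot_of_le {f : Ω → EReal} {g : Ω → ℝ} (hg : Integrable g μ)
    (hle : ∀ᵐ r ∂μ, (g r : EReal) ≤ f r) : eInt μ f ≠ ⊥ := by
  have hB : ∫⁻ r, ePos (-(f r)) ∂μ ≠ ⊤ := by
    refine ne_top_of_le_ne_top hg.neg.lintegral_lt_top.ne (lintegral_mono_ae ?_)
    filter_upwards [hle] with r hr
    rw [Pi.neg_apply, ← ePos_neg_coe]
    exact ePos_mono (EReal.neg_le_neg_iff.2 hr)
  rw [eInt]
  lift (∫⁻ r, ePos (-(f r)) ∂μ) to NNReal using hB with B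
  intro h
  rw [sub_eq_add_neg, EReal.add_eq_bot_iff] at h
  rcases h with h | h
  · exact EReal.coe_ennreal_ne_bot _ h
  · simp at h

theorem xInt_eq_integral {X p : Ω → ℝ} (h : Integrable (fun r => X r * p r) μ) :
    xInt μ X p = ((∫ r, X r * p r ∂μ : ℝ) : EReal) :=
  eInt_eq_integral (f := fun r => ((X r * p r : ℝ) : EReal))
    (ae_of_all _ fun _ => ⟨EReal.coe_ne_top _, EReal.coe_ne_bot _⟩)
    (by simpa only [EReal.toReal_coe] using h)

theorem integrable_of_xInt_eq_coe {X p : Ω → ℝ} (hX : Measurable X) (hp : AEMeasurable p μ)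
    {c : ℝ} (h : xInt μ X p = (c : EReal)) :
    Integrable (fun r => X r * p r) μ ∧ ∫ r, X r * p r ∂μ = c :=
  (integrable_of_eInt_eq_coe (hX.aemeasurable.mul hp).coe_real_ereal h).2

end ExtendedIntegral

section Integrand

/-- The smallest positive multiple of `1 / (n + 1)` that exceeds `s ≥ 0`. -/
noncomputable def upperGrid (n : ℕ) (s : ℝ) : ℝ := ((⌊s * (n + 1)⌋₊ : ℝ) + 1) / (n + 1)

theorem tendsto_upperGrid {s : ℝ} (hs : 0 ≤ s) :
    Tendsto (fun n => upperGrid n s) atTop (𝓝[>] s) := by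
  have hlt : ∀ n : ℕ, s < upperGrid n s := fun n => by
    have hn : (0 : ℝ) < n + 1 := by positivity
    rw [upperGrid, lt_div_iff₀ hn]
    exact Nat.lt_floor_add_one _
  have hle : ∀ n : ℕ, upperGrid n s ≤ s + 1 / ((n : ℝ) + 1) := fun n => by
    have hn : (0 : ℝ) < n + 1 := by positivity
    have h1 : (⌊s * (n + 1)⌋₊ : ℝ) ≤ s * (n + 1) := Nat.floor_le (by positivity)
    rw [upperGrid, div_le_iff₀ hn, add_mul, one_div_mul_cancel hn.ne']
    linarith
  refine tendsto_nhdsWithin_iff.2 ⟨?_, Eventually.of_forall hlt⟩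
  refine tendsto_of_tendsto_of_tendsto_of_le_of_le tendsto_const_nhds ?_
    (fun n => (hlt n).le) hle
  simpa using (tendsto_const_nhds (x := s)).add (tendsto_one_div_add_atTop_nhds_zero_nat (𝕜 := ℝ))

/-- An enumeration of the positive rationals. -/
noncomputable def posGrid (n : ℕ) : ℝ := ((n.unpair.1 : ℝ) + 1) / (n.unpair.2 + 1)

theorem posGrid_pos (n : ℕ) : 0 < posGrid n := by
  unfold posGrid
  positivity

theorem posGrid_pair_floor (n : ℕ) (s : ℝ) :
    posGrid (Nat.pair ⌊s * (n + 1)⌋₊ n) = upperGrid n s := by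
  simp [posGrid, upperGrid]

variable {Ω : Type*} [MeasurableSpace Ω] {μ : Measure Ω} {β : Ω → ℝ → EReal} {β' : Ω → ℝ → ℝ}
  {X p₀ : Ω → ℝ} {b₀ : ℝ}

theorem Standing.tendsto_right (hst : Standing μ β β' X p₀ b₀) (r : Ω) {s : ℝ} (hs : 0 ≤ s) :
    Tendsto (β r) (𝓝[>] s) (𝓝 (β r s)) := by
  rcases hs.eq_or_lt with rfl | hs
  · exact hst.betaZero r
  have hcoe : ∀ t : ℝ, 0 < t → (((β r t).toReal : ℝ) : EReal) = β r t := fun t ht =>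
    EReal.coe_toReal (hst.betaFin r t ht) (hst.betaNeBot r t)
  have hc : ContinuousAt (fun t => (((β r t).toReal : ℝ) : EReal)) s :=
    continuous_coe_real_ereal.continuousAt.comp (hst.betaDeriv r s hs).continuousAt
  have h := hc.tendsto.mono_left (nhdsWithin_le_nhds (s := Ioi s))
  rw [hcoe s hs] at h
  refine h.congr' ?_
  filter_upwards [self_mem_nhdsWithin] with t ht
  exact hcoe t (hs.trans ht)

theorem Standing.measurable_comp (hst : Standing μ β β' X p₀ b₀) {p : Ω → ℝ} (hp : Measurable p)
    (h0 : ∀ r, 0 ≤ p r) : Measurable (fun r => β r (p r)) := by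
  refine measurable_of_tendsto_metrizable (f := fun n r => β r (upperGrid n (p r))) (fun n => ?_)
    (tendsto_pi_nhds.2 fun r => (hst.tendsto_right r (h0 r)).comp (tendsto_upperGrid (h0 r)))
  have h1 : Measurable (fun x : Ω × ℕ => β x.1 (((x.2 : ℝ) + 1) / (n + 1))) :=
    measurable_from_prod_countable_left fun m => hst.betaMeas (((m : ℝ) + 1) / (n + 1))
  exact h1.comp (measurable_id.prodMk (Nat.measurable_floor.comp (hp.mul_const _)))

theorem Standing.tendsto_right_toReal (hst : Standing μ β β' X p₀ b₀) (r : Ω) {s : ℝ}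
    (hs : 0 ≤ s) (hfin : β r s ≠ ⊤) :
    Tendsto (fun ε => (β r (s + ε)).toReal) (𝓝[>] 0) (𝓝 (β r s).toReal) := by
  have h1 : Tendsto (fun ε : ℝ => s + ε) (𝓝[>] 0) (𝓝[>] s) := by
    refine tendsto_nhdsWithin_iff.2 ⟨?_, ?_⟩
    · have : Tendsto (fun ε : ℝ => s + ε) (𝓝 0) (𝓝 (s + 0)) := tendsto_const_nhds.add tendsto_id
      rw [add_zero] at this
      exact this.mono_left nhdsWithin_le_nhds
    · filter_upwards [self_mem_nhdsWithin] with ε hε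
      simpa using hε
  exact ((EReal.tendsto_toReal hfin (hst.betaNeBot r s)).comp (hst.tendsto_right r hs)).comp h1

/-- Jensen's inequality for the integrand on its whole effective domain. -/
theorem Standing.convex (hst : Standing μ β β' X p₀ b₀) (r : Ω) {s₁ s₂ v w : ℝ}
    (h₁ : 0 ≤ s₁) (h₂ : 0 ≤ s₂) (hf₁ : β r s₁ ≠ ⊤) (hf₂ : β r s₂ ≠ ⊤) (hv : 0 ≤ v)
    (hw : 0 ≤ w) (hvw : v + w = 1) :
    β r (v * s₁ + w * s₂) ≠ ⊤ ∧
      (β r (v * s₁ + w * s₂)).toReal ≤ v * (β r s₁).toReal + w * (β r s₂).toReal := by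
  have h0 : 0 ≤ v * s₁ + w * s₂ := by positivity
  have hfin : β r (v * s₁ + w * s₂) ≠ ⊤ := by
    rcases h0.eq_or_lt with h | h
    · rw [← h]
      have hz1 : v * s₁ = 0 := by nlinarith [mul_nonneg hv h₁, mul_nonneg hw h₂]
      have hz2 : w * s₂ = 0 := by linarith
      rcases mul_eq_zero.1 hz1 with h' | h'
      · rcases mul_eq_zero.1 hz2 with h'' | h''
        · linarith
        · rwa [← h'']
      · rwa [← h']
    · exact hst.betaFin r _ h
  refine ⟨hfin, ?_⟩
  refine le_of_tendsto_of_tendsto (hst.tendsto_right_toReal r h0 hfin)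
    (((hst.tendsto_right_toReal r h₁ hf₁).const_mul v).add
      ((hst.tendsto_right_toReal r h₂ hf₂).const_mul w)) ?_
  filter_upwards [self_mem_nhdsWithin] with ε hε
  have hε' : 0 < ε := hε
  have := (hst.betaConv r).convexOn.2 (x := s₁ + ε) (y := s₂ + ε) (by simp; linarith)
    (by simp; linarith) hv hw hvw
  simp only [smul_eq_mul] at this
  convert this using 3
  linear_combination -ε * hvw

theorem conjβ_eq_iSup_posGrid (hst : Standing μ β β' X p₀ b₀) (r : Ω) (τ : ℝ) :
    conjβ β r τ = ⨆ n, (((posGrid n * τ : ℝ) : EReal) - β r (posGrid n)) := by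
  refine le_antisymm (iSup_le fun s => ?_) (iSup_le fun n => le_iSup_of_le (posGrid n) le_rfl)
  rcases lt_or_ge s 0 with hs | hs
  · simp [hst.betaNeg r s hs]
  · have h1 : Tendsto (fun n => ((upperGrid n s * τ : ℝ) : EReal) - β r (upperGrid n s)) atTop
        (𝓝 (((s * τ : ℝ) : EReal) - β r s)) := by
      have ha : Tendsto (fun n => ((upperGrid n s * τ : ℝ) : EReal)) atTop
          (𝓝 ((s * τ : ℝ) : EReal)) :=
        (continuous_coe_real_ereal.tendsto _).comp
          (((tendsto_upperGrid hs).mono_right nhdsWithin_le_nhds).mul_const τ)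
      have hb : Tendsto (fun n => -β r (upperGrid n s)) atTop (𝓝 (-β r s)) :=
        (continuous_neg.tendsto _).comp ((hst.tendsto_right r hs).comp (tendsto_upperGrid hs))
      have hc := EReal.continuousAt_add (p := (((s * τ : ℝ) : EReal), -β r s))
        (Or.inl (EReal.coe_ne_top _)) (Or.inl (EReal.coe_ne_bot _))
      simp only [sub_eq_add_neg]
      exact hc.tendsto.comp (ha.prodMk_nhds hb)
    refine le_of_tendsto h1 (Eventually.of_forall fun n => ?_)
    rw [← posGrid_pair_floor]
    exact le_iSup (fun m => (((posGrid m * τ : ℝ) : EReal) - β r (posGrid m))) _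

theorem measurable_conjβ (hst : Standing μ β β' X p₀ b₀) (θ₁ θ₂ : ℝ) :
    Measurable (fun r => conjβ β r (θ₁ + θ₂ * X r)) := by
  simp only [conjβ_eq_iSup_posGrid hst]
  refine Measurable.iSup fun n => ?_
  have hX := hst.Xmeas
  have h1 : Measurable (fun r => ((posGrid n * (θ₁ + θ₂ * X r) : ℝ) : EReal)) :=
    Measurable.coe_real_ereal (by fun_prop)
  exact h1.sub (hst.betaMeas _)

/-- The Fenchel–Young inequality. -/
theorem coe_sub_le_conjβ (hst : Standing μ β β' X p₀ b₀) (r : Ω) {s : ℝ} (τ : ℝ)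
    (hs : β r s ≠ ⊤) : ((s * τ - (β r s).toReal : ℝ) : EReal) ≤ conjβ β r τ := by
  refine le_iSup_of_le s ?_
  rw [EReal.coe_sub, EReal.coe_toReal hs (hst.betaNeBot r s)]

theorem conjβ_ne_bot (hst : Standing μ β β' X p₀ b₀) (r : Ω) (τ : ℝ) : conjβ β r τ ≠ ⊥ :=
  ne_bot_of_le_ne_bot (EReal.coe_ne_bot _)
    (coe_sub_le_conjβ hst r τ (hst.betaFin r 1 one_pos))

theorem sub_le_toReal_conjβ (hst : Standing μ β β' X p₀ b₀) (r : Ω) {s τ : ℝ}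
    (hs : β r s ≠ ⊤) (hτ : conjβ β r τ ≠ ⊤) :
    s * τ - (β r s).toReal ≤ (conjβ β r τ).toReal := by
  rw [← EReal.coe_le_coe_iff, EReal.coe_toReal hτ (conjβ_ne_bot hst r τ)]
  exact coe_sub_le_conjβ hst r τ hs

theorem conjβ_le_coe (hst : Standing μ β β' X p₀ b₀) (r : Ω) {τ c : ℝ}
    (h : ∀ s, 0 ≤ s → β r s ≠ ⊤ → s * τ - (β r s).toReal ≤ c) :
    conjβ β r τ ≤ (c : EReal) := by
  refine iSup_le fun s => ?_
  by_cases hs : β r s = ⊤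
  · simp [hs]
  · have h0 : 0 ≤ s := by
      by_contra! hneg
      exact hs (hst.betaNeg r s hneg)
    rw [← EReal.coe_toReal hs (hst.betaNeBot r s), ← EReal.coe_sub]
    exact EReal.coe_le_coe_iff.2 (h s h0 hs)

theorem conjβ_mono (hst : Standing μ β β' X p₀ b₀) (r : Ω) : Monotone (conjβ β r) := by
  intro τ τ' h
  by_cases hτ : conjβ β r τ' = ⊤
  · simp [hτ]
  rw [← EReal.coe_toReal hτ (conjβ_ne_bot hst r τ')]
  refine conjβ_le_coe hst r fun s h0 hs => ?_
  have := sub_le_toReal_conjβ hst r hs hτ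
  nlinarith [mul_le_mul_of_nonneg_left h h0]

theorem conjβ_convex (hst : Standing μ β β' X p₀ b₀) (r : Ω) {τ₁ τ₂ v w : ℝ}
    (h₁ : conjβ β r τ₁ ≠ ⊤) (h₂ : conjβ β r τ₂ ≠ ⊤) (hv : 0 ≤ v) (hw : 0 ≤ w) (hvw : v + w = 1) :
    conjβ β r (v * τ₁ + w * τ₂) ≠ ⊤ ∧ (conjβ β r (v * τ₁ + w * τ₂)).toReal ≤
      v * (conjβ β r τ₁).toReal + w * (conjβ β r τ₂).toReal := by
  have h : conjβ β r (v * τ₁ + w * τ₂) ≤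
      ((v * (conjβ β r τ₁).toReal + w * (conjβ β r τ₂).toReal : ℝ) : EReal) := by
    refine conjβ_le_coe hst r fun s _ hs => ?_
    have e1 := mul_le_mul_of_nonneg_left (sub_le_toReal_conjβ hst r hs h₁) hv
    have e2 := mul_le_mul_of_nonneg_left (sub_le_toReal_conjβ hst r hs h₂) hw
    linear_combination e1 + e2 + (β r s).toReal * hvw
  have ht := ne_top_of_le_ne_top (EReal.coe_ne_top _) h
  refine ⟨ht, ?_⟩
  rwa [← EReal.coe_le_coe_iff, EReal.coe_toReal ht (conjβ_ne_bot hst r _)]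

end Integrand

section Admissible

variable {Ω : Type*} [MeasurableSpace Ω] {μ : Measure Ω} {β : Ω → ℝ → EReal} {β' : Ω → ℝ → ℝ}
  {X p₀ : Ω → ℝ} {b₀ : ℝ}

/-- Nonnegative functions with finite mass, payoff and entropy. -/
structure IsAdmissible (μ : Measure Ω) (β : Ω → ℝ → EReal) (X p : Ω → ℝ) : Prop where
  meas : Measurable p
  nonneg : ∀ r, 0 ≤ p r
  int : Integrable p μ
  intX : Integrable (fun r => X r * p r) μ
  fin : ∀ᵐ r ∂μ, β r (p r) ≠ ⊤
  intβ : Integrable (fun r => (β r (p r)).toReal) μ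

theorem IsAdmissible.hfun_eq (hst : Standing μ β β' X p₀ b₀) {p : Ω → ℝ}
    (hp : IsAdmissible μ β X p) : Hfun μ β p = ((∫ r, (β r (p r)).toReal ∂μ : ℝ) : EReal) :=
  eInt_eq_integral (hp.fin.mono fun r hr => ⟨hr, hst.betaNeBot r _⟩) hp.intβ

theorem IsAdmissible.isDensity {p : Ω → ℝ} (hp : IsAdmissible μ β X p) (h1 : ∫ r, p r ∂μ = 1) :
    IsDensity μ p := by
  refine ⟨hp.meas, hp.nonneg, ?_⟩
  rw [← ofReal_integral_eq_lintegral_ofReal hp.int (ae_of_all _ hp.nonneg), h1,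
    ENNReal.ofReal_one]

theorem IsDensity.integrable {p : Ω → ℝ} (hp : IsDensity μ p) : Integrable p μ :=
  ⟨hp.1.aestronglyMeasurable, by
    rw [hasFiniteIntegral_iff_ofReal (ae_of_all _ hp.2.1), hp.2.2]
    exact ENNReal.one_lt_top⟩

theorem IsDensity.integral_eq_one {p : Ω → ℝ} (hp : IsDensity μ p) : ∫ r, p r ∂μ = 1 := by
  rw [integral_eq_lintegral_of_nonneg_ae (ae_of_all _ hp.2.1) hp.1.aestronglyMeasurable, hp.2.2,
    ENNReal.toReal_one]

theorem IsDensity.isAdmissible (hst : Standing μ β β' X p₀ b₀) {p : Ω → ℝ} (hp : IsDensity μ p)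
    {h v : ℝ} (hH : Hfun μ β p ≤ (h : EReal)) (hX : xInt μ X p = (v : EReal)) :
    IsAdmissible μ β X p := by
  have h1 := finite_of_eInt (hst.measurable_comp hp.1 hp.2.1).aemeasurable
    (ne_top_of_le_ne_top (EReal.coe_ne_top _) hH)
    (ne_bot_of_le_ne_bot EReal.zero_ne_bot (hst.Hnonneg p hp))
  exact ⟨hp.1, hp.2.1, hp.integrable,
    (integrable_of_xInt_eq_coe hst.Xmeas hp.1.aemeasurable hX).1, h1.1.mono fun r hr => hr.1, h1.2⟩

theorem Standing.admissible₀ (hst : Standing μ β β' X p₀ b₀) : IsAdmissible μ β X p₀ :=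
  hst.dens₀.isAdmissible hst (h := 0) (by simp [hst.H₀]) hst.payoff₀

theorem Standing.integral_payoff₀ (hst : Standing μ β β' X p₀ b₀) : ∫ r, X r * p₀ r ∂μ = b₀ :=
  (integrable_of_xInt_eq_coe hst.Xmeas hst.dens₀.1.aemeasurable hst.payoff₀).2

theorem Standing.integral_entropy₀ (hst : Standing μ β β' X p₀ b₀) :
    ∫ r, (β r (p₀ r)).toReal ∂μ = 0 := by
  have h := hst.admissible₀.hfun_eq hst
  rw [hst.H₀] at h
  exact_mod_cast h.symm

theorem IsAdmissible.integrable_affine {p : Ω → ℝ} (hp : IsAdmissible μ β X p) (θ₁ θ₂ : ℝ) :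
    Integrable (fun r => p r * (θ₁ + θ₂ * X r)) μ := by
  have h := (hp.int.const_mul θ₁).add (hp.intX.const_mul θ₂)
  refine h.congr (ae_of_all _ fun r => ?_)
  simp only [Pi.add_apply]
  ring

theorem IsAdmissible.integral_affine {p : Ω → ℝ} (hp : IsAdmissible μ β X p) (θ₁ θ₂ : ℝ) :
    ∫ r, p r * (θ₁ + θ₂ * X r) ∂μ = θ₁ * ∫ r, p r ∂μ + θ₂ * ∫ r, X r * p r ∂μ := by
  rw [← integral_const_mul, ← integral_const_mul,
    ← integral_add (hp.int.const_mul θ₁) (hp.intX.const_mul θ₂)]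
  exact integral_congr_ae (ae_of_all _ fun r => by ring)

theorem Kfun_ne_bot (hst : Standing μ β β' X p₀ b₀) (θ₁ θ₂ : ℝ) : Kfun μ β X θ₁ θ₂ ≠ ⊥ := by
  refine eInt_ne_bot_of_le ((hst.admissible₀.integrable_affine θ₁ θ₂).sub hst.admissible₀.intβ) ?_
  filter_upwards [hst.admissible₀.fin] with r hr
  exact coe_sub_le_conjβ hst r _ hr

/-- The real-valued version of `K`, meaningful on `domK`. -/
noncomputable def Kreal (μ : Measure Ω) (β : Ω → ℝ → EReal) (X : Ω → ℝ) (θ : ℝ × ℝ) : ℝ :=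
  ∫ r, (conjβ β r (θ.1 + θ.2 * X r)).toReal ∂μ

theorem mem_domK_iff (hst : Standing μ β β' X p₀ b₀) (θ : ℝ × ℝ) :
    θ ∈ domK μ β X ↔ (∀ᵐ r ∂μ, conjβ β r (θ.1 + θ.2 * X r) ≠ ⊤) ∧
      Integrable (fun r => (conjβ β r (θ.1 + θ.2 * X r)).toReal) μ := by
  constructor
  · intro h
    have h1 := finite_of_eInt (measurable_conjβ hst θ.1 θ.2).aemeasurable (ne_of_lt h)
      (Kfun_ne_bot hst θ.1 θ.2)
    exact ⟨h1.1.mono fun r hr => hr.1, h1.2⟩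
  · rintro ⟨h1, h2⟩
    have := eInt_eq_integral (h1.mono fun r hr => ⟨hr, conjβ_ne_bot hst r _⟩) h2
    change Kfun μ β X θ.1 θ.2 < ⊤
    rw [Kfun, this]
    exact EReal.coe_lt_top _

theorem Kfun_eq_Kreal (hst : Standing μ β β' X p₀ b₀) {θ : ℝ × ℝ} (h : θ ∈ domK μ β X) :
    Kfun μ β X θ.1 θ.2 = (Kreal μ β X θ : EReal) :=
  eInt_eq_integral (((mem_domK_iff hst θ).1 h).1.mono fun r hr => ⟨hr, conjβ_ne_bot hst r _⟩)
    ((mem_domK_iff hst θ).1 h).2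

/-- The integrated Fenchel–Young inequality. -/
theorem IsAdmissible.le_Kreal (hst : Standing μ β β' X p₀ b₀) {p : Ω → ℝ}
    (hp : IsAdmissible μ β X p) {θ : ℝ × ℝ} (hθ : θ ∈ domK μ β X) :
    θ.1 * ∫ r, p r ∂μ + θ.2 * ∫ r, X r * p r ∂μ - ∫ r, (β r (p r)).toReal ∂μ ≤ Kreal μ β X θ := by
  obtain ⟨h1, h2⟩ := (mem_domK_iff hst θ).1 hθ
  rw [← hp.integral_affine, ← integral_sub (hp.integrable_affine _ _) hp.intβ]
  refine integral_mono_ae ((hp.integrable_affine _ _).sub hp.intβ) h2 ?_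
  filter_upwards [h1, hp.fin] with r hr hr'
  exact sub_le_toReal_conjβ hst r hr' hr

theorem convex_domK (hst : Standing μ β β' X p₀ b₀) : Convex ℝ (domK μ β X) := by
  intro θ hθ θ' hθ' v w hv hw hvw
  obtain ⟨h1, h2⟩ := (mem_domK_iff hst θ).1 hθ
  obtain ⟨h1', h2'⟩ := (mem_domK_iff hst θ').1 hθ'
  have hle := fun r (a : conjβ β r (θ.1 + θ.2 * X r) ≠ ⊤)
    (a' : conjβ β r (θ'.1 + θ'.2 * X r) ≠ ⊤) => conjβ_convex hst r a a' hv hw hvw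
  have harg : ∀ r, (v • θ + w • θ').1 + (v • θ + w • θ').2 * X r =
      v * (θ.1 + θ.2 * X r) + w * (θ'.1 + θ'.2 * X r) := fun r => by
    simp only [Prod.fst_add, Prod.snd_add, Prod.smul_fst, Prod.smul_snd, smul_eq_mul]
    ring
  rw [mem_domK_iff hst]
  have hfin : ∀ᵐ r ∂μ, conjβ β r ((v • θ + w • θ').1 + (v • θ + w • θ').2 * X r) ≠ ⊤ := by
    filter_upwards [h1, h1'] with r hr hr'
    rw [harg]
    exact (hle r hr hr').1
  refine ⟨hfin, ?_⟩
  refine integrable_of_le_of_le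
    (measurable_conjβ hst _ _).ereal_toReal.aestronglyMeasurable
    (g₁ := fun r => p₀ r * ((v • θ + w • θ').1 + (v • θ + w • θ').2 * X r) - (β r (p₀ r)).toReal)
    ?_ ?_ ((hst.admissible₀.integrable_affine _ _).sub hst.admissible₀.intβ)
    ((h2.const_mul v).add (h2'.const_mul w))
  · filter_upwards [hfin, hst.admissible₀.fin] with r hr hr'
    exact sub_le_toReal_conjβ hst r hr' hr
  · filter_upwards [h1, h1'] with r hr hr'
    rw [harg]
    exact (hle r hr hr').2

/-- Once `dom K` is nonempty, admissible functions form a convex set on which the entropy is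
convex. -/
theorem IsAdmissible.convex (hst : Standing μ β β' X p₀ b₀) {θ : ℝ × ℝ} (hθ : θ ∈ domK μ β X)
    {p q : Ω → ℝ} (hp : IsAdmissible μ β X p) (hq : IsAdmissible μ β X q) {v w : ℝ}
    (hv : 0 ≤ v) (hw : 0 ≤ w) (hvw : v + w = 1) :
    IsAdmissible μ β X (fun r => v * p r + w * q r) ∧
      ∫ r, (β r (v * p r + w * q r)).toReal ∂μ ≤
        v * ∫ r, (β r (p r)).toReal ∂μ + w * ∫ r, (β r (q r)).toReal ∂μ := by
  obtain ⟨h1, h2⟩ := (mem_domK_iff hst θ).1 hθ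
  have hmeas : Measurable (fun r => v * p r + w * q r) :=
    (hp.meas.const_mul v).add (hq.meas.const_mul w)
  have hnn : ∀ r, 0 ≤ v * p r + w * q r := fun r => by
    have := hp.nonneg r
    have := hq.nonneg r
    positivity
  have hfin : ∀ᵐ r ∂μ, β r (v * p r + w * q r) ≠ ⊤ := by
    filter_upwards [hp.fin, hq.fin] with r hr hr'
    exact (hst.convex r (hp.nonneg r) (hq.nonneg r) hr hr' hv hw hvw).1
  have hle : ∀ᵐ r ∂μ, (β r (v * p r + w * q r)).toReal ≤
      v * (β r (p r)).toReal + w * (β r (q r)).toReal := by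
    filter_upwards [hp.fin, hq.fin] with r hr hr'
    exact (hst.convex r (hp.nonneg r) (hq.nonneg r) hr hr' hv hw hvw).2
  have hint : Integrable (fun r => (β r (v * p r + w * q r)).toReal) μ := by
    have haff := ((hp.integrable_affine θ.1 θ.2).const_mul v).add
      ((hq.integrable_affine θ.1 θ.2).const_mul w)
    refine integrable_of_le_of_le (hst.measurable_comp hmeas hnn).ereal_toReal.aestronglyMeasurable
      ?_ hle (haff.sub h2) ((hp.intβ.const_mul v).add (hq.intβ.const_mul w))
    filter_upwards [h1, hfin] with r hr hr'
    have := sub_le_toReal_conjβ hst r hr' hr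
    simp only [Pi.add_apply, Pi.sub_apply]
    linarith
  refine ⟨⟨hmeas, hnn, (hp.int.const_mul v).add (hq.int.const_mul w), ?_, hfin, hint⟩, ?_⟩
  · refine ((hp.intX.const_mul v).add (hq.intX.const_mul w)).congr (ae_of_all _ fun r => ?_)
    simp only [Pi.add_apply]
    ring
  · rw [← integral_const_mul, ← integral_const_mul,
      ← integral_add (hp.intβ.const_mul v) (hq.intβ.const_mul w)]
    exact integral_mono_ae hint ((hp.intβ.const_mul v).add (hq.intβ.const_mul w)) hle

theorem IsAdmissible.integral_convex {p q : Ω → ℝ} (hp : IsAdmissible μ β X p)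
    (hq : IsAdmissible μ β X q) (v w : ℝ) :
    ∫ r, (v * p r + w * q r) ∂μ = v * ∫ r, p r ∂μ + w * ∫ r, q r ∂μ ∧
      ∫ r, X r * (v * p r + w * q r) ∂μ =
        v * ∫ r, X r * p r ∂μ + w * ∫ r, X r * q r ∂μ := by
  constructor
  · rw [← integral_const_mul, ← integral_const_mul,
      ← integral_add (hp.int.const_mul v) (hq.int.const_mul w)]
  · rw [← integral_const_mul, ← integral_const_mul,
      ← integral_add (hp.intX.const_mul v) (hq.intX.const_mul w)]
    exact integral_congr_ae (ae_of_all _ fun r => by ring)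

end Admissible

section Interchange

variable {Ω : Type*} [MeasurableSpace Ω] {μ : Measure Ω} {β : Ω → ℝ → EReal} {β' : Ω → ℝ → ℝ}
  {X p₀ : Ω → ℝ} {b₀ : ℝ}

/-- The Lagrangian integrand `s (θ₁ + θ₂ X(r)) − η β(r, s)`. -/
noncomputable def lagr (β : Ω → ℝ → EReal) (X : Ω → ℝ) (θ : ℝ × ℝ) (η : ℝ) (r : Ω) (s : ℝ) : ℝ :=
  s * (θ.1 + θ.2 * X r) - η * (β r s).toReal

theorem IsAdmissible.integrable_lagr {p : Ω → ℝ} (hp : IsAdmissible μ β X p) (θ : ℝ × ℝ) (η : ℝ) :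
    Integrable (fun r => lagr β X θ η r (p r)) μ :=
  (hp.integrable_affine _ _).sub (hp.intβ.const_mul η)

theorem IsAdmissible.integral_lagr {p : Ω → ℝ} (hp : IsAdmissible μ β X p) (θ : ℝ × ℝ) (η : ℝ) :
    ∫ r, lagr β X θ η r (p r) ∂μ = θ.1 * ∫ r, p r ∂μ + θ.2 * ∫ r, X r * p r ∂μ -
      η * ∫ r, (β r (p r)).toReal ∂μ := by
  unfold lagr
  rw [integral_sub (hp.integrable_affine _ _) (hp.intβ.const_mul η), hp.integral_affine,
    integral_const_mul]

theorem Standing.measurable_lagr (hst : Standing μ β β' X p₀ b₀) {q : Ω → ℝ} (hq : Measurable q)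
    (hq0 : ∀ r, 0 ≤ q r) (θ : ℝ × ℝ) (η : ℝ) : Measurable (fun r => lagr β X θ η r (q r)) := by
  have hX := hst.Xmeas
  have h := (hst.measurable_comp hq hq0).ereal_toReal
  unfold lagr
  fun_prop

/-- An exhausting sequence of sets of finite measure on which `X`, `q` and `β(·, q)` are bounded. -/
def boundedSet (μ : Measure Ω) [SigmaFinite μ] (β : Ω → ℝ → EReal) (X q : Ω → ℝ) (n : ℕ) : Set Ω :=
  spanningSets μ n ∩ {r | q r ≤ n ∧ |X r| ≤ n ∧ |(β r (q r)).toReal| ≤ n}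

theorem measurableSet_boundedSet [SigmaFinite μ] (hst : Standing μ β β' X p₀ b₀) {q : Ω → ℝ}
    (hq : Measurable q) (hq0 : ∀ r, 0 ≤ q r) (n : ℕ) :
    MeasurableSet (boundedSet μ β X q n) :=
  (measurableSet_spanningSets μ n).inter ((measurableSet_le hq measurable_const).inter
    ((measurableSet_le hst.Xmeas.abs measurable_const).inter
      (measurableSet_le (hst.measurable_comp hq hq0).ereal_toReal.abs measurable_const)))

theorem monotone_boundedSet [SigmaFinite μ] (q : Ω → ℝ) : Monotone (boundedSet μ β X q) := by
  intro m n hmn r ⟨h1, h2, h3, h4⟩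
  have h : (m : ℝ) ≤ n := by exact_mod_cast hmn
  exact ⟨monotone_spanningSets μ hmn h1, h2.trans h, h3.trans h, h4.trans h⟩

theorem exists_mem_boundedSet [SigmaFinite μ] (q : Ω → ℝ) (r : Ω) :
    ∃ n, r ∈ boundedSet μ β X q n := by
  obtain ⟨n₁, h1⟩ := mem_iUnion.1 ((iUnion_spanningSets μ).symm ▸ mem_univ r)
  obtain ⟨n₂, h2⟩ := exists_nat_ge (max (q r) (max |X r| |(β r (q r)).toReal|))
  have h3 : (n₂ : ℝ) ≤ (max n₁ n₂ : ℕ) := by exact_mod_cast le_max_right _ _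
  simp only [max_le_iff] at h2
  exact ⟨max n₁ n₂, monotone_spanningSets μ (le_max_left _ _) h1, h2.1.trans h3, h2.2.1.trans h3,
    h2.2.2.trans h3⟩

/-- Changing an admissible density on a subset of a bounded set keeps it admissible. -/
theorem Standing.admissible_piecewise [SigmaFinite μ] (hst : Standing μ β β' X p₀ b₀) {q : Ω → ℝ}
    (hq : Measurable q) (hq0 : ∀ r, 0 ≤ q r) (hqfin : ∀ᵐ r ∂μ, β r (q r) ≠ ⊤) {E : Set Ω}
    [DecidablePred (· ∈ E)] (hE : MeasurableSet E) {n : ℕ} (hsub : E ⊆ boundedSet μ β X q n) :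
    IsAdmissible μ β X (E.piecewise q p₀) := by
  have hp := hst.admissible₀
  have hEfin : μ E < ⊤ := (measure_mono (hsub.trans inter_subset_left)).trans_lt
    (measure_spanningSets_lt_top μ n)
  have hbdd : ∀ {f : Ω → ℝ} (c : ℝ), Measurable f → (∀ r ∈ E, |f r| ≤ c) → IntegrableOn f E μ :=
    fun c hf hc => Measure.integrableOn_of_bounded hEfin.ne hf.aestronglyMeasurable (M := c)
      ((ae_restrict_iff' hE).2 (ae_of_all _ hc))
  have hX : (fun r => X r * E.piecewise q p₀ r) =
      E.piecewise (fun r => X r * q r) (fun r => X r * p₀ r) := by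
    ext r
    by_cases hr : r ∈ E <;> simp [hr]
  have hβ : (fun r => (β r (E.piecewise q p₀ r)).toReal) =
      E.piecewise (fun r => (β r (q r)).toReal) (fun r => (β r (p₀ r)).toReal) := by
    ext r
    by_cases hr : r ∈ E <;> simp [hr]
  refine ⟨hq.piecewise hE hp.meas, fun r => ?_, ?_, ?_, ?_, ?_⟩
  · by_cases hr : r ∈ E
    · simpa [hr] using hq0 r
    · simpa [hr] using hp.nonneg r
  · refine Integrable.piecewise hE (hbdd n hq fun r hr => ?_) hp.int.integrableOn
    rw [abs_of_nonneg (hq0 r)]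
    exact (hsub hr).2.1
  · rw [hX]
    refine Integrable.piecewise hE (hbdd (n * n) (hst.Xmeas.mul hq) fun r hr => ?_)
      hp.intX.integrableOn
    obtain ⟨-, h1, h2, -⟩ := hsub hr
    rw [abs_mul, abs_of_nonneg (hq0 r)]
    exact mul_le_mul h2 h1 (hq0 r) (Nat.cast_nonneg n)
  · filter_upwards [hqfin, hp.fin] with r h1 h2
    by_cases hr : r ∈ E
    · simpa [hr] using h1
    · simpa [hr] using h2
  · rw [hβ]
    exact Integrable.piecewise hE
      (hbdd n (hst.measurable_comp hq hq0).ereal_toReal fun r hr => (hsub hr).2.2.2)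
      hp.intβ.integrableOn

/-- An upper bound for the Lagrangian over admissible functions bounds the integrated pointwise
gain over the reference density. -/
theorem lintegral_gain_le (hst : Standing μ β β' X p₀ b₀) {θ : ℝ × ℝ} {η C : ℝ}
    (hC : ∀ p, IsAdmissible μ β X p → ∫ r, lagr β X θ η r (p r) ∂μ ≤ C) {q : Ω → ℝ}
    (hq : Measurable q) (hq0 : ∀ r, 0 ≤ q r) (hqfin : ∀ᵐ r ∂μ, β r (q r) ≠ ⊤) :
    ∫⁻ r, ENNReal.ofReal (lagr β X θ η r (q r) - lagr β X θ η r (p₀ r)) ∂μ ≤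
      ENNReal.ofReal (C - ∫ r, lagr β X θ η r (p₀ r) ∂μ) := by
  classical
  have := hst.sigma
  have hp := hst.admissible₀
  set g : Ω → ℝ := fun r => lagr β X θ η r (q r) - lagr β X θ η r (p₀ r) with hg
  have hgm : Measurable g :=
    (hst.measurable_lagr hq hq0 θ η).sub (hst.measurable_lagr hp.meas hp.nonneg θ η)
  set E : ℕ → Set Ω := fun n => boundedSet μ β X q n ∩ {r | 0 ≤ g r} with hE
  have hEm : ∀ n, MeasurableSet (E n) := fun n =>
    (measurableSet_boundedSet hst hq hq0 n).inter (measurableSet_le measurable_const hgm)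
  have hmono : Monotone E := fun m n hmn =>
    inter_subset_inter_left _ (monotone_boundedSet q hmn)
  have hU : ∫⁻ r, ENNReal.ofReal (g r) ∂μ = ∫⁻ r in ⋃ n, E n, ENNReal.ofReal (g r) ∂μ := by
    rw [← lintegral_indicator (MeasurableSet.iUnion hEm)]
    refine lintegral_congr fun r => ?_
    by_cases hr : r ∈ ⋃ n, E n
    · rw [indicator_of_mem hr]
    · rw [indicator_of_notMem hr, ENNReal.ofReal_eq_zero]
      by_contra! hpos
      obtain ⟨n, hn⟩ := exists_mem_boundedSet (μ := μ) (β := β) (X := X) q r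
      exact hr (mem_iUnion.2 ⟨n, hn, hpos.le⟩)
  rw [hU, setLIntegral_iUnion_of_directed _ hmono.directed_le]
  refine iSup_le fun n => ?_
  have had := hst.admissible_piecewise hq hq0 hqfin (hEm n) (n := n) inter_subset_left
  have hind : (E n).indicator g = fun r =>
      lagr β X θ η r ((E n).piecewise q p₀ r) - lagr β X θ η r (p₀ r) := by
    ext r
    by_cases hr : r ∈ E n <;> simp [hr, hg]
  have hint : IntegrableOn g (E n) μ := by
    rw [← integrable_indicator_iff (hEm n)]
    simp only [hind]
    exact (had.integrable_lagr θ η).sub (hp.integrable_lagr θ η)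
  rw [← ofReal_integral_eq_lintegral_ofReal hint
    ((ae_restrict_iff' (hEm n)).2 (ae_of_all _ fun r hr => hr.2))]
  refine ENNReal.ofReal_le_ofReal ?_
  rw [← integral_indicator (hEm n)]
  simp only [hind]
  rw [integral_sub (had.integrable_lagr θ η) (hp.integrable_lagr θ η)]
  linarith [hC _ had]

/-- The running maximiser of the Lagrangian integrand over `p₀` and the first points of the
enumeration of positive rationals. -/
noncomputable def gridMaximiser (β : Ω → ℝ → EReal) (X p₀ : Ω → ℝ) (θ : ℝ × ℝ) : ℕ → Ω → ℝ
  | 0 => p₀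
  | n + 1 => fun r =>
    if lagr β X θ 1 r (gridMaximiser β X p₀ θ n r) < lagr β X θ 1 r (posGrid n) then posGrid n
    else gridMaximiser β X p₀ θ n r

theorem gridMaximiser_spec (hst : Standing μ β β' X p₀ b₀) (θ : ℝ × ℝ) (n : ℕ) :
    Measurable (gridMaximiser β X p₀ θ n) ∧ (∀ r, 0 ≤ gridMaximiser β X p₀ θ n r) ∧
      ∀ r, β r (p₀ r) ≠ ⊤ → β r (gridMaximiser β X p₀ θ n r) ≠ ⊤ := by
  induction n with
  | zero => exact ⟨hst.admissible₀.meas, hst.admissible₀.nonneg, fun r hr => hr⟩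
  | succ n ih =>
    obtain ⟨h1, h2, h3⟩ := ih
    refine ⟨?_, fun r => ?_, fun r hr => ?_⟩
    · exact Measurable.ite (measurableSet_lt (hst.measurable_lagr h1 h2 θ 1)
        (hst.measurable_lagr measurable_const (fun _ => (posGrid_pos n).le) θ 1))
        measurable_const h1
    · simp only [gridMaximiser]
      split_ifs
      exacts [(posGrid_pos n).le, h2 r]
    · simp only [gridMaximiser]
      split_ifs
      exacts [hst.betaFin r _ (posGrid_pos n), h3 r hr]

theorem monotone_lagr_gridMaximiser {ι : Type*} {β : ι → ℝ → EReal} {X p₀ : ι → ℝ} (θ : ℝ × ℝ)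
    (r : ι) :
    Monotone (fun n => lagr β X θ 1 r (gridMaximiser β X p₀ θ n r)) := by
  refine monotone_nat_of_le_succ fun n => ?_
  simp only [gridMaximiser]
  split_ifs with h
  exacts [h.le, le_rfl]

theorem lagr_posGrid_le {ι : Type*} {β : ι → ℝ → EReal} {X p₀ : ι → ℝ} (θ : ℝ × ℝ) (r : ι)
    (n : ℕ) :
    lagr β X θ 1 r (posGrid n) ≤ lagr β X θ 1 r (gridMaximiser β X p₀ θ (n + 1) r) := by
  simp only [gridMaximiser]
  split_ifs with h
  exacts [le_rfl, not_lt.1 h]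

/-- Interchange of supremum and integral: `K(θ)` is the supremum of the Lagrangian over
admissible functions. -/
theorem Kreal_le_of_forall (hst : Standing μ β β' X p₀ b₀) {θ : ℝ × ℝ} {C : ℝ}
    (hC : ∀ p, IsAdmissible μ β X p → ∫ r, lagr β X θ 1 r (p r) ∂μ ≤ C) :
    θ ∈ domK μ β X ∧ Kreal μ β X θ ≤ C := by
  have hp := hst.admissible₀
  set f₀ : Ω → ℝ := fun r => lagr β X θ 1 r (p₀ r) with hf₀
  have hf₀i : Integrable f₀ μ := hp.integrable_lagr θ 1
  set f : ℕ → Ω → ℝ≥0∞ := fun n r =>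
    ENNReal.ofReal (lagr β X θ 1 r (gridMaximiser β X p₀ θ n r) - f₀ r) with hf
  have hfm : ∀ n, Measurable (f n) := fun n =>
    ((hst.measurable_lagr (gridMaximiser_spec hst θ n).1 (gridMaximiser_spec hst θ n).2.1 θ 1).sub
      (hst.measurable_lagr hp.meas hp.nonneg θ 1)).ennreal_ofReal
  have hfmono : Monotone f := fun m n hmn r => ENNReal.ofReal_le_ofReal
    (sub_le_sub_right (monotone_lagr_gridMaximiser θ r hmn) _)
  have hsup : ∫⁻ r, ⨆ n, f n r ∂μ ≤ ENNReal.ofReal (C - ∫ r, f₀ r ∂μ) := by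
    rw [lintegral_iSup hfm hfmono]
    exact iSup_le fun n => lintegral_gain_le hst hC (gridMaximiser_spec hst θ n).1
      (gridMaximiser_spec hst θ n).2.1 (hp.fin.mono (gridMaximiser_spec hst θ n).2.2)
  have hne : ∫⁻ r, ⨆ n, f n r ∂μ ≠ ⊤ := ne_top_of_le_ne_top ENNReal.ofReal_ne_top hsup
  have hGm : Measurable (fun r => ⨆ n, f n r) := Measurable.iSup hfm
  have hGi : Integrable (fun r => (⨆ n, f n r).toReal) μ :=
    integrable_toReal_of_lintegral_ne_top hGm.aemeasurable hne
  have hup : ∀ᵐ r ∂μ, conjβ β r (θ.1 + θ.2 * X r) ≤ ((f₀ r + (⨆ n, f n r).toReal : ℝ) : EReal) := by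
    filter_upwards [ae_lt_top hGm hne] with r hr
    rw [conjβ_eq_iSup_posGrid hst]
    refine iSup_le fun n => ?_
    rw [← EReal.coe_toReal (hst.betaFin r _ (posGrid_pos n)) (hst.betaNeBot r _), ← EReal.coe_sub,
      EReal.coe_le_coe_iff]
    have h1 : f (n + 1) r ≤ ⨆ n, f n r := le_iSup (fun n => f n r) (n + 1)
    have h2 := (ENNReal.ofReal_le_iff_le_toReal hr.ne).1 h1
    have h3 := lagr_posGrid_le (β := β) (X := X) (p₀ := p₀) θ r n
    have h4 : lagr β X θ 1 r (posGrid n) =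
      posGrid n * (θ.1 + θ.2 * X r) - (β r (posGrid n)).toReal := by simp [lagr]
    linarith
  have hfin : ∀ᵐ r ∂μ, conjβ β r (θ.1 + θ.2 * X r) ≠ ⊤ :=
    hup.mono fun r hr => ne_top_of_le_ne_top (EReal.coe_ne_top _) hr
  have hup' : ∀ᵐ r ∂μ, (conjβ β r (θ.1 + θ.2 * X r)).toReal ≤ f₀ r + (⨆ n, f n r).toReal := by
    filter_upwards [hup, hfin] with r h1 h2
    rwa [← EReal.coe_le_coe_iff, EReal.coe_toReal h2 (conjβ_ne_bot hst r _)]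
  have hint : Integrable (fun r => (conjβ β r (θ.1 + θ.2 * X r)).toReal) μ := by
    refine integrable_of_le_of_le (measurable_conjβ hst _ _).ereal_toReal.aestronglyMeasurable
      ?_ hup' hf₀i (hf₀i.add hGi)
    filter_upwards [hfin, hp.fin] with r h1 h2
    simpa [hf₀, lagr] using sub_le_toReal_conjβ hst r h2 h1
  refine ⟨(mem_domK_iff hst θ).2 ⟨hfin, hint⟩, ?_⟩
  have h1 : Kreal μ β X θ ≤ ∫ r, (f₀ r + (⨆ n, f n r).toReal) ∂μ :=
    integral_mono_ae hint (hf₀i.add hGi) hup'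
  rw [integral_add hf₀i hGi, integral_toReal hGm.aemeasurable (ae_lt_top hGm hne)] at h1
  have h2 := ENNReal.toReal_mono ENNReal.ofReal_ne_top hsup
  rw [ENNReal.toReal_ofReal (sub_nonneg.2 (hC p₀ hp))] at h2
  linarith

end Interchange

section Duality

variable {Ω : Type*} [MeasurableSpace Ω] {μ : Measure Ω} {β : Ω → ℝ → EReal} {β' : Ω → ℝ → ℝ}
  {X p₀ : Ω → ℝ} {b₀ : ℝ}

theorem Standing.measure_ne_zero (hst : Standing μ β β' X p₀ b₀) : μ ≠ 0 := by
  rintro rfl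
  simpa using hst.dens₀.2.2

/-- A linear functional of mass and payoff that is maximal at `(1, b)`, with `b` above the
essential infimum of `X`, and decreasing in the payoff is zero. -/
theorem eq_zero_of_forall_lagr_le (hst : Standing μ β β' X p₀ b₀) {θ : ℝ × ℝ} {b : ℝ}
    (hb : essInfX μ X < (b : EReal)) (hθ : θ.2 ≤ 0)
    (hC : ∀ p, IsAdmissible μ β X p → ∫ r, lagr β X θ 0 r (p r) ∂μ ≤ θ.1 + θ.2 * b) :
    θ = 0 := by
  have hp := hst.admissible₀
  set C := θ.1 + θ.2 * b with hCdef
  set C₀ := ∫ r, lagr β X θ 0 r (p₀ r) ∂μ with hC₀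
  have hC₀C : C₀ ≤ C := hC p₀ hp
  have hX := hst.Xmeas
  have hτ : ∀ᵐ r ∂μ, θ.1 + θ.2 * X r ≤ 0 := by
    have hbound : ∀ n : ℕ, (n : ℝ≥0∞) * ∫⁻ r, ENNReal.ofReal (θ.1 + θ.2 * X r) ∂μ ≤
        ENNReal.ofReal (C - C₀) := fun n => by
      rcases n.eq_zero_or_pos with rfl | hn
      · simp
      have hn' : (0 : ℝ) < n := by exact_mod_cast hn
      have h1 := lintegral_gain_le hst hC (q := fun r => p₀ r + n) (hp.meas.add_const _)
        (fun r => add_nonneg (hp.nonneg r) hn'.le)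
        (ae_of_all _ fun r => hst.betaFin r _ (add_pos_of_nonneg_of_pos (hp.nonneg r) hn'))
      rw [← lintegral_const_mul _ (by fun_prop)]
      refine le_trans (le_of_eq (lintegral_congr fun r => ?_)) h1
      rw [← ENNReal.ofReal_natCast, ← ENNReal.ofReal_mul hn'.le]
      congr 1
      simp only [lagr]
      ring
    have hz : ∫⁻ r, ENNReal.ofReal (θ.1 + θ.2 * X r) ∂μ = 0 := by
      by_contra hne
      obtain ⟨n, hn⟩ := ENNReal.exists_nat_mul_gt hne (b := ENNReal.ofReal (C - C₀))
        ENNReal.ofReal_ne_top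
      exact absurd (hbound n) (not_le.2 hn)
    rw [lintegral_eq_zero_iff (by fun_prop)] at hz
    filter_upwards [hz] with r hr
    simpa using hr
  have hC0 : 0 ≤ C := by
    have hscaled : ∀ n : ℕ, C₀ * (1 / ((n : ℝ) + 1)) ≤ C := fun n => by
      have hn : (0 : ℝ) < 1 / ((n : ℝ) + 1) := by positivity
      have h1 := lintegral_gain_le hst hC (q := fun r => p₀ r * (1 / ((n : ℝ) + 1)))
        (hp.meas.mul_const _) (fun r => mul_nonneg (hp.nonneg r) hn.le) (by
          filter_upwards [hp.fin] with r hr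
          rcases (hp.nonneg r).eq_or_lt with h | h
          · rw [← h] at hr ⊢
            simpa using hr
          · exact hst.betaFin r _ (mul_pos h hn))
      have hgain : ∀ r, lagr β X θ 0 r (p₀ r * (1 / ((n : ℝ) + 1))) - lagr β X θ 0 r (p₀ r) =
          (1 / ((n : ℝ) + 1) - 1) * lagr β X θ 0 r (p₀ r) := fun r => by
        simp only [lagr]
        ring
      have hle1 : 1 / ((n : ℝ) + 1) - 1 ≤ 0 := by
        rw [sub_nonpos, div_le_one (by positivity)]
        linarith [(Nat.cast_nonneg n : (0 : ℝ) ≤ n)]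
      simp only [hgain] at h1
      rw [← ofReal_integral_eq_lintegral_ofReal ((hp.integrable_lagr θ 0).const_mul _) (by
        filter_upwards [hτ] with r hr
        refine mul_nonneg_of_nonpos_of_nonpos hle1 ?_
        simpa [lagr] using mul_nonpos_of_nonneg_of_nonpos (hp.nonneg r) hr),
        integral_const_mul, ENNReal.ofReal_le_ofReal_iff (sub_nonneg.2 hC₀C)] at h1
      linarith
    have hlim : Tendsto (fun n : ℕ => C₀ * (1 / ((n : ℝ) + 1))) atTop (𝓝 (C₀ * 0)) :=
      tendsto_one_div_add_atTop_nhds_zero_nat.const_mul C₀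
    rw [mul_zero] at hlim
    exact le_of_tendsto hlim (Eventually.of_forall hscaled)
  rcases hθ.eq_or_lt with h2 | h2
  · have : (ae μ).NeBot := ae_neBot.2 hst.measure_ne_zero
    obtain ⟨r, hr⟩ := hτ.exists
    rw [h2, zero_mul, add_zero] at hr
    rw [hCdef, h2, zero_mul, add_zero] at hC0
    exact Prod.ext (le_antisymm hr hC0) h2
  · refine absurd hb (not_lt.2 ?_)
    refine le_essInf_of_ae_le _ ?_
    filter_upwards [hτ] with r hr
    rw [EReal.coe_le_coe_iff]
    nlinarith

/-- The values of mass, payoff and entropy dominated by an admissible function. -/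
def attainableSet (μ : Measure Ω) (β : Ω → ℝ → EReal) (X : Ω → ℝ) : Set (ℝ × ℝ × ℝ) :=
  {x | ∃ p, IsAdmissible μ β X p ∧ ∫ r, p r ∂μ = x.1 ∧ ∫ r, X r * p r ∂μ ≤ x.2.1 ∧
    ∫ r, (β r (p r)).toReal ∂μ ≤ x.2.2}

theorem convex_attainableSet (hst : Standing μ β β' X p₀ b₀) {θ : ℝ × ℝ} (hθ : θ ∈ domK μ β X) :
    Convex ℝ (attainableSet μ β X) := by
  rintro ⟨x₁, x₂, x₃⟩ ⟨p, hp, h1, h2, h3⟩ ⟨y₁, y₂, y₃⟩ ⟨q, hq, h1', h2', h3'⟩ v w hv hw hvw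
  obtain ⟨ha, hle⟩ := hp.convex hst hθ hq hv hw hvw
  obtain ⟨e1, e2⟩ := hp.integral_convex hq v w
  simp only at h1 h2 h3 h1' h2' h3'
  refine ⟨_, ha, ?_, ?_, ?_⟩
  · simp [e1, h1, h1']
  · rw [e2]
    exact add_le_add (mul_le_mul_of_nonneg_left h2 hv) (mul_le_mul_of_nonneg_left h2' hw)
  · exact hle.trans
      (add_le_add (mul_le_mul_of_nonneg_left h3 hv) (mul_le_mul_of_nonneg_left h3' hw))

theorem exists_admissible_one_lt_integral (hst : Standing μ β β' X p₀ b₀) :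
    ∃ p, IsAdmissible μ β X p ∧ 1 < ∫ r, p r ∂μ := by
  classical
  have := hst.sigma
  have hp := hst.admissible₀
  set q : Ω → ℝ := fun r => p₀ r + 1 with hq
  have hqm : Measurable q := hp.meas.add_const _
  have hqpos : ∀ r, 0 < q r := fun r => add_pos_of_nonneg_of_pos (hp.nonneg r) one_pos
  obtain ⟨n, hn⟩ : ∃ n, μ (boundedSet μ β X q n) ≠ 0 := by
    by_contra! h
    refine hst.measure_ne_zero (Measure.measure_univ_eq_zero.1 ?_)
    rw [← iUnion_eq_univ_iff.2 (exists_mem_boundedSet (μ := μ) (β := β) (X := X) q)]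
    exact measure_iUnion_null h
  set E := boundedSet μ β X q n with hE
  have hEm : MeasurableSet E := measurableSet_boundedSet hst hqm (fun r => (hqpos r).le) n
  have had := hst.admissible_piecewise hqm (fun r => (hqpos r).le)
    (ae_of_all μ fun r => hst.betaFin r _ (hqpos r)) hEm (subset_refl E)
  refine ⟨_, had, ?_⟩
  have hind : (fun r => E.piecewise q p₀ r - p₀ r) = E.indicator (fun _ => 1) := by
    ext r
    by_cases hr : r ∈ E <;> simp [hr, hq]
  have h1 := integral_sub had.int hp.int
  rw [hind, integral_indicator hEm, setIntegral_const, hst.dens₀.integral_eq_one,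
    smul_eq_mul, mul_one] at h1
  have hEfin : μ E ≠ ⊤ := ((measure_mono inter_subset_left).trans_lt
    (measure_spanningSets_lt_top μ n)).ne
  have h2 : 0 < μ.real E := ENNReal.toReal_pos hn hEfin
  linarith

theorem interior_attainableSet_nonempty (hst : Standing μ β β' X p₀ b₀) {θ : ℝ × ℝ}
    (hθ : θ ∈ domK μ β X) : (interior (attainableSet μ β X)).Nonempty := by
  obtain ⟨p, hp, hu⟩ := exists_admissible_one_lt_integral hst
  have hp₀ := hst.admissible₀
  set u := ∫ r, p r ∂μ with hudef
  set c := max (∫ r, X r * p₀ r ∂μ) (∫ r, X r * p r ∂μ) with hc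
  set d := max (∫ r, (β r (p₀ r)).toReal ∂μ) (∫ r, (β r (p r)).toReal ∂μ) with hd
  have hsub : Ioo 1 u ×ˢ Ioi c ×ˢ Ioi d ⊆ attainableSet μ β X := by
    rintro ⟨x, y, z⟩ ⟨⟨hx1, hx2⟩, hy, hz⟩
    simp only [mem_Ioi] at hx1 hx2 hy hz
    have hu' : u - 1 ≠ 0 := by linarith
    set t := (x - 1) / (u - 1) with ht
    have ht0 : 0 ≤ t := div_nonneg (by linarith) (by linarith)
    have ht1 : 0 ≤ 1 - t := by
      rw [sub_nonneg, ht, div_le_one (by linarith)]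
      linarith
    obtain ⟨ha, hle⟩ := hp₀.convex hst hθ hp ht1 ht0 (by ring)
    obtain ⟨e1, e2⟩ := hp₀.integral_convex hp (1 - t) t
    refine ⟨_, ha, ?_, ?_, ?_⟩
    · rw [e1, hst.dens₀.integral_eq_one, ← hudef]
      simp only [ht]
      field_simp
      ring
    · rw [e2]
      have h1 := mul_le_mul_of_nonneg_left (le_max_left _ _ : _ ≤ c) ht1
      have h2 := mul_le_mul_of_nonneg_left (le_max_right _ _ : _ ≤ c) ht0
      simp only
      linarith
    · have h1 := mul_le_mul_of_nonneg_left (le_max_left _ _ : _ ≤ d) ht1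
      have h2 := mul_le_mul_of_nonneg_left (le_max_right _ _ : _ ≤ d) ht0
      simp only
      linarith
  refine Nonempty.mono (interior_maximal hsub
    (isOpen_Ioo.prod (isOpen_Ioi.prod isOpen_Ioi))) ⟨((1 + u) / 2, c + 1, d + 1), ?_⟩
  refine ⟨⟨?_, ?_⟩, ?_, ?_⟩ <;> simp <;> linarith

variable {k b : ℝ}

theorem le_integral_of_entropy_le (hst : Standing μ β β' X p₀ b₀)
    (hb : Vfun μ β X k = (b : EReal)) {p : Ω → ℝ} (hp : IsAdmissible μ β X p)
    (h1 : ∫ r, p r ∂μ = 1) (hk : ∫ r, (β r (p r)).toReal ∂μ ≤ k) : b ≤ ∫ r, X r * p r ∂μ := by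
  rw [← EReal.coe_le_coe_iff, ← xInt_eq_integral hp.intX, ← hb]
  refine iInf_le_of_le ⟨p, hp.isDensity h1, ?_⟩ le_rfl
  rw [hp.hfun_eq hst]
  exact_mod_cast hk

theorem exists_admissible_lt (hst : Standing μ β β' X p₀ b₀)
    (hb : Vfun μ β X k = (b : EReal)) {c : ℝ} (hc : b < c) :
    ∃ p, IsAdmissible μ β X p ∧ ∫ r, p r ∂μ = 1 ∧ ∫ r, (β r (p r)).toReal ∂μ ≤ k ∧
      ∫ r, X r * p r ∂μ < c := by
  have h : Vfun μ β X k < (c : EReal) := by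
    rw [hb]
    exact_mod_cast hc
  obtain ⟨⟨p, hp, hH⟩, hlt⟩ := iInf_lt_iff.1 h
  have hge : (b : EReal) ≤ xInt μ X p := hb ▸ iInf_le_of_le ⟨p, hp, hH⟩ le_rfl
  have hx : ((xInt μ X p).toReal : EReal) = xInt μ X p :=
    EReal.coe_toReal (ne_top_of_lt hlt) (ne_bot_of_le_ne_bot (EReal.coe_ne_bot b) hge)
  have had := hp.isAdmissible hst hH hx.symm
  refine ⟨p, had, hp.integral_eq_one, ?_, ?_⟩
  · rw [had.hfun_eq hst] at hH
    exact_mod_cast hH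
  · rw [xInt_eq_integral had.intX] at hlt
    exact_mod_cast hlt

/-- Weak duality. -/
theorem le_Kreal_of_Vfun_eq (hst : Standing μ β β' X p₀ b₀) (hb : Vfun μ β X k = (b : EReal))
    {θ : ℝ × ℝ} (hθ : θ ∈ domK μ β X) : θ.1 + θ.2 * b - k ≤ Kreal μ β X θ := by
  refine le_of_forall_pos_le_add fun ε hε => ?_
  have hd : 0 < |θ.2| + 1 := by positivity
  obtain ⟨p, hp, h1, hk, hlt⟩ := exists_admissible_lt hst hb (c := b + ε / (|θ.2| + 1))
    (by linarith [div_pos hε hd])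
  have hge := le_integral_of_entropy_le hst hb hp h1 hk
  have hF := hp.le_Kreal hst hθ
  rw [h1] at hF
  have h2 : θ.2 * (b - ∫ r, X r * p r ∂μ) ≤ ε := by
    calc θ.2 * (b - ∫ r, X r * p r ∂μ) ≤ |θ.2 * (b - ∫ r, X r * p r ∂μ)| := le_abs_self _
      _ = |θ.2| * ((∫ r, X r * p r ∂μ) - b) := by
        rw [abs_mul, abs_sub_comm, abs_of_nonneg (sub_nonneg.2 hge)]
      _ ≤ (|θ.2| + 1) * (ε / (|θ.2| + 1)) :=
        mul_le_mul (by linarith) (by linarith) (sub_nonneg.2 hge) hd.le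
      _ = ε := mul_div_cancel₀ _ hd.ne'
  linarith

theorem essInfX_lt_of_lt_kmax (hst : Standing μ β β' X p₀ b₀) {θ : ℝ × ℝ}
    (hθ : θ ∈ domK μ β X) (hk : 0 < k) (hkmax : (k : EReal) < kmax μ β X b₀)
    (hb : Vfun μ β X k = (b : EReal)) : essInfX μ X < (b : EReal) := by
  obtain ⟨⟨c, hc1, hc2⟩, hF⟩ := lt_iSup_iff.1 hkmax
  refine hc1.trans_le (EReal.coe_le_coe_iff.2 ?_)
  by_contra! hbc
  obtain ⟨p, hp, h1, hpk, hlt⟩ := exists_admissible_lt hst hb hbc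
  have hp₀ := hst.admissible₀
  set x := ∫ r, X r * p r ∂μ with hx
  have hpos : 0 < b₀ - x := by linarith
  set t := (c - x) / (b₀ - x) with ht
  have ht0 : 0 ≤ t := div_nonneg (by linarith) hpos.le
  have ht1 : 0 ≤ 1 - t := by
    rw [sub_nonneg, ht, div_le_one hpos]
    linarith
  have htx : t * (b₀ - x) = c - x := div_mul_cancel₀ _ hpos.ne'
  obtain ⟨ha, hle⟩ := hp.convex hst hθ hp₀ ht1 ht0 (by ring)
  obtain ⟨e1, e2⟩ := hp.integral_convex hp₀ (1 - t) t
  rw [h1, hst.dens₀.integral_eq_one] at e1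
  rw [← hx, hst.integral_payoff₀] at e2
  rw [hst.integral_entropy₀] at hle
  refine absurd hF (not_lt.2 ?_)
  refine iInf_le_of_le ⟨_, ha.isDensity (by linarith), ?_⟩ ?_
  · rw [xInt_eq_integral ha.intX, e2]
    congr 1
    linarith
  · rw [ha.hfun_eq hst, EReal.coe_le_coe_iff]
    nlinarith [mul_le_mul_of_nonneg_left hpk ht1, mul_nonneg ht0 hk.le]

theorem notMem_interior_attainableSet (hst : Standing μ β β' X p₀ b₀)
    (hb : Vfun μ β X k = (b : EReal)) : (1, b, k) ∉ interior (attainableSet μ β X) := by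
  intro h
  have hcont : Tendsto (fun ε : ℝ => ((1 : ℝ), b - ε, k)) (𝓝[>] 0) (𝓝 (1, b, k)) := by
    have : Continuous (fun ε : ℝ => ((1 : ℝ), b - ε, k)) := by fun_prop
    simpa using (this.tendsto 0).mono_left (nhdsWithin_le_nhds (s := Ioi 0))
  obtain ⟨ε, ⟨p, hp, h1, h2, h3⟩, hε⟩ :=
    ((hcont.eventually (mem_interior_iff_mem_nhds.1 h)).and self_mem_nhdsWithin).exists
  have := le_integral_of_entropy_le hst hb hp h1 h3
  have hε' : 0 < ε := hε
  simp only at h2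
  linarith

/-- Strong duality: the dual problem is solvable at every level `k ∈ (0, k_max)`. -/
theorem exists_Kreal_le (hst : Standing μ β β' X p₀ b₀) {θ : ℝ × ℝ}
    (hθ : θ ∈ domK μ β X) (hk : 0 < k) (hkmax : (k : EReal) < kmax μ β X b₀)
    (hb : Vfun μ β X k = (b : EReal)) :
    ∃ ϑ : ℝ × ℝ, ϑ.2 < 0 ∧ ϑ ∈ domK μ β X ∧ Kreal μ β X ϑ ≤ ϑ.1 + ϑ.2 * b - k := by
  obtain ⟨f, hf0, hf⟩ := geometric_hahn_banach_of_nonempty_interior_point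
    (convex_attainableSet hst hθ) (notMem_interior_attainableSet hst hb)
    (interior_attainableSet_nonempty hst hθ)
  set α := f (1, 0, 0) with hα
  set γ := f (0, 1, 0) with hγ
  set η := -f (0, 0, 1) with hη
  have hfx : ∀ x y z : ℝ, f (x, y, z) = x * α + y * γ - z * η := fun x y z => by
    have : ((x, y, z) : ℝ × ℝ × ℝ) =
        x • ((1 : ℝ), (0 : ℝ), (0 : ℝ)) + y • ((0 : ℝ), (1 : ℝ), (0 : ℝ)) +
          z • ((0 : ℝ), (0 : ℝ), (1 : ℝ)) := by simp
    rw [this, map_add, map_add, map_smul, map_smul, map_smul, hα, hγ, hη]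
    simp only [smul_eq_mul]
    ring
  have hadm : ∀ p, IsAdmissible μ β X p → ∀ s t, 0 ≤ s → 0 ≤ t →
      (∫ r, p r ∂μ) * α + (∫ r, X r * p r ∂μ + s) * γ -
        (∫ r, (β r (p r)).toReal ∂μ + t) * η ≤ α + b * γ - k * η := fun p hp s t hs ht => by
    have := hf (∫ r, p r ∂μ, ∫ r, X r * p r ∂μ + s, ∫ r, (β r (p r)).toReal ∂μ + t)
      ⟨p, hp, rfl, by simpa using hs, by simpa using ht⟩
    rw [hfx, hfx] at this
    linarith
  have hp₀ := hst.admissible₀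
  have hline : ∀ {A B c : ℝ}, (∀ s, 0 ≤ s → A + s * c ≤ B) → c ≤ 0 := fun {A B c} h => by
    by_contra! hc
    have := h ((|B - A| + 1) / c) (by positivity)
    rw [div_mul_cancel₀ _ hc.ne'] at this
    linarith [le_abs_self (B - A)]
  have h₀ : ∀ s t, 0 ≤ s → 0 ≤ t → α + (b₀ + s) * γ - t * η ≤ α + b * γ - k * η :=
    fun s t hs ht => by
      have := hadm p₀ hp₀ s t hs ht
      rw [hst.dens₀.integral_eq_one, hst.integral_payoff₀, hst.integral_entropy₀] at this
      linarith
  have hγ0 : γ ≤ 0 := hline (A := α + b₀ * γ) (B := α + b * γ - k * η) fun s hs => by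
    have := h₀ s 0 hs le_rfl
    linarith
  have hη0 : 0 ≤ η := by
    have : -η ≤ 0 := hline (A := α + b₀ * γ) (B := α + b * γ - k * η) fun t ht => by
      have := h₀ 0 t le_rfl ht
      linarith
    linarith
  have hlagr : ∀ p, IsAdmissible μ β X p →
      ∫ r, lagr β X (α, γ) η r (p r) ∂μ ≤ α + b * γ - k * η := fun p hp => by
    have := hadm p hp 0 0 le_rfl le_rfl
    rw [hp.integral_lagr]
    simp only
    linarith
  have hηpos : 0 < η := by
    refine hη0.lt_of_ne fun hz => hf0 ?_
    rw [← hz] at hlagr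
    have h := eq_zero_of_forall_lagr_le hst (essInfX_lt_of_lt_kmax hst hθ hk hkmax hb)
      (θ := (α, γ)) hγ0 (fun p hp => by have := hlagr p hp; simp only; linarith)
    have hα0 : α = 0 := congrArg Prod.fst h
    have hγ0' : γ = 0 := congrArg Prod.snd h
    refine ContinuousLinearMap.ext fun ⟨x, y, z⟩ => ?_
    rw [hfx, hα0, hγ0', ← hz]
    simp
  have hscale : ∀ p, IsAdmissible μ β X p →
      ∫ r, lagr β X (α / η, γ / η) 1 r (p r) ∂μ ≤ α / η + γ / η * b - k := fun p hp => by
    have := hlagr p hp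
    rw [hp.integral_lagr] at this ⊢
    simp only at this ⊢
    refine le_of_mul_le_mul_left ?_ hηpos
    field_simp
    linarith
  obtain ⟨hdom, hK⟩ := Kreal_le_of_forall hst hscale
  refine ⟨(α / η, γ / η), ?_, hdom, hK⟩
  refine (div_nonpos_of_nonpos_of_nonneg hγ0 hη0).lt_of_ne fun hz => ?_
  have := hscale p₀ hp₀
  rw [hp₀.integral_lagr, hst.dens₀.integral_eq_one, hst.integral_entropy₀] at this
  simp only [hz] at this
  linarith

end Duality

section NormalCone

variable {Ω : Type*} [MeasurableSpace Ω] {μ : Measure Ω} {β : Ω → ℝ → EReal} {β' : Ω → ℝ → ℝ}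
  {X p₀ : Ω → ℝ} {b₀ : ℝ}

theorem HasDerivAt.tendsto_nat_slope {g : ℝ → ℝ} {g' τ : ℝ} (h : HasDerivAt g g' τ) (δ : ℝ) :
    Tendsto (fun n : ℕ => ((n : ℝ) + 1) * (g (τ + 1 / ((n : ℝ) + 1) * δ) - g τ)) atTop
      (𝓝 (g' * δ)) := by
  have hline : HasDerivAt (fun t : ℝ => τ + t * δ) δ 0 := by
    simpa using ((hasDerivAt_id (0 : ℝ)).mul_const δ).const_add τ
  have h0 : HasDerivAt g g' (τ + 0 * δ) := by simpa using h
  have hslope := (h0.comp (0 : ℝ) hline).tendsto_slope_zero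
  have hseq : Tendsto (fun n : ℕ => 1 / ((n : ℝ) + 1)) atTop (𝓝[≠] 0) :=
    tendsto_nhdsWithin_iff.2 ⟨tendsto_one_div_add_atTop_nhds_zero_nat,
      Eventually.of_forall fun n => (by positivity : (0 : ℝ) < 1 / ((n : ℝ) + 1)).ne'⟩
  refine (hslope.comp hseq).congr fun n => ?_
  simp

/-- Along a segment in the domain of the conjugate, difference quotients are bounded by the
full increment. -/
theorem slope_conjβ_le (hst : Standing μ β β' X p₀ b₀) {r : Ω} {τ δ : ℝ}
    (hτ : conjβ β r τ ≠ ⊤) (hδ : conjβ β r (τ + δ) ≠ ⊤) (n : ℕ) :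
    ((n : ℝ) + 1) * ((conjβ β r (τ + 1 / ((n : ℝ) + 1) * δ)).toReal - (conjβ β r τ).toReal) ≤
      (conjβ β r (τ + δ)).toReal - (conjβ β r τ).toReal := by
  have hn : (0 : ℝ) < n + 1 := by positivity
  have hle : 1 / ((n : ℝ) + 1) ≤ 1 := by
    rw [div_le_one hn]
    linarith [n.cast_nonneg (α := ℝ)]
  have h := (conjβ_convex hst r hτ hδ (sub_nonneg.2 hle) (by positivity)
    (sub_add_cancel 1 (1 / ((n : ℝ) + 1)))).2
  rw [show (1 - 1 / ((n : ℝ) + 1)) * τ + 1 / ((n : ℝ) + 1) * (τ + δ) =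
    τ + 1 / ((n : ℝ) + 1) * δ by ring] at h
  set A := (conjβ β r (τ + 1 / ((n : ℝ) + 1) * δ)).toReal
  set B := (conjβ β r τ).toReal
  set C := (conjβ β r (τ + δ)).toReal
  have h' : A - B ≤ 1 / ((n : ℝ) + 1) * (C - B) := by linarith
  calc ((n : ℝ) + 1) * (A - B) ≤ (n + 1) * (1 / ((n : ℝ) + 1) * (C - B)) :=
        mul_le_mul_of_nonneg_left h' hn.le
    _ = C - B := by field_simp

theorem deriv_mul_le_conjβ_sub (hst : Standing μ β β' X p₀ b₀) {r : Ω} {τ δ g' : ℝ}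
    (h : HasDerivAt (fun t => (conjβ β r t).toReal) g' τ)
    (hτ : conjβ β r τ ≠ ⊤) (hδ : conjβ β r (τ + δ) ≠ ⊤) :
    g' * δ ≤ (conjβ β r (τ + δ)).toReal - (conjβ β r τ).toReal :=
  le_of_tendsto' (h.tendsto_nat_slope δ) (slope_conjβ_le hst hτ hδ)

theorem deriv_conjβ_nonneg (hst : Standing μ β β' X p₀ b₀) {r : Ω} {τ g' : ℝ}
    (h : HasDerivAt (fun t => (conjβ β r t).toReal) g' τ) (hτ : conjβ β r τ ≠ ⊤) : 0 ≤ g' := by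
  have hle := conjβ_mono hst r (show τ + -1 ≤ τ by linarith)
  have := deriv_mul_le_conjβ_sub hst h hτ (ne_top_of_le_ne_top hτ hle)
  have := EReal.toReal_le_toReal hle (conjβ_ne_bot hst r _) hτ
  linarith

/-- The derivative of the conjugate at a parameter in `Θ`. -/
theorem ae_hasDerivAt_pFam {ψ : Ω → ℝ → ℝ} (hψ : IsConjDeriv β β' ψ) {θ₁ θ₂ : ℝ}
    (hθ : (θ₁, θ₂) ∈ ThetaSet μ β β' X) :
    ∀ᵐ r ∂μ, HasDerivAt (fun t => (conjβ β r t).toReal) (pFam ψ X θ₁ θ₂ r) (θ₁ + θ₂ * X r) :=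
  hθ.2.mono fun r hr => hψ r _ hr

theorem aemeasurable_pFam (hst : Standing μ β β' X p₀ b₀) {ψ : Ω → ℝ → ℝ}
    (hψ : IsConjDeriv β β' ψ) {θ₁ θ₂ : ℝ} (hθ : (θ₁, θ₂) ∈ ThetaSet μ β β' X) :
    AEMeasurable (pFam ψ X θ₁ θ₂) μ := by
  refine aemeasurable_of_tendsto_metrizable_ae atTop
    (f := fun (n : ℕ) r => ((n : ℝ) + 1) *
      ((conjβ β r (θ₁ + 1 / ((n : ℝ) + 1) + θ₂ * X r)).toReal -
        (conjβ β r (θ₁ + θ₂ * X r)).toReal)) (fun n => ?_) ?_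
  · exact (((measurable_conjβ hst _ _).ereal_toReal.sub
      (measurable_conjβ hst _ _).ereal_toReal).const_mul _).aemeasurable
  · filter_upwards [ae_hasDerivAt_pFam hψ hθ] with r hr
    simpa [add_right_comm] using hr.tendsto_nat_slope 1

theorem integrable_pFam (hst : Standing μ β β' X p₀ b₀) {ψ : Ω → ℝ → ℝ}
    (hψ : IsConjDeriv β β' ψ) {θ₁ θ₂ : ℝ} (hθ : (θ₁, θ₂) ∈ ThetaSet μ β β' X) {a : ℝ}
    (ha : pInt μ (pFam ψ X θ₁ θ₂) = ENNReal.ofReal a) (ha0 : 0 ≤ a) :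
    Integrable (pFam ψ X θ₁ θ₂) μ ∧ ∫ r, pFam ψ X θ₁ θ₂ r ∂μ = a := by
  have hm := (aemeasurable_pFam hst hψ hθ).aestronglyMeasurable
  have h0 : 0 ≤ᵐ[μ] pFam ψ X θ₁ θ₂ := by
    filter_upwards [ae_hasDerivAt_pFam hψ hθ, ((mem_domK_iff hst _).1 hθ.1).1] with r hr hf
    exact deriv_conjβ_nonneg hst hr hf
  refine ⟨⟨hm, ?_⟩, ?_⟩
  · rw [hasFiniteIntegral_iff_ofReal h0]
    exact lt_of_eq_of_lt ha ENNReal.ofReal_lt_top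
  · rw [integral_eq_lintegral_of_nonneg_ae h0 hm]
    exact (congrArg ENNReal.toReal ha).trans (ENNReal.toReal_ofReal ha0)

/-- `Kreal` is differentiable at points of `Θ` along segments in `dom K`, and its difference
quotients dominate the directional derivative. -/
theorem tendsto_slope_Kreal (hst : Standing μ β β' X p₀ b₀) {ψ : Ω → ℝ → ℝ}
    (hψ : IsConjDeriv β β' ψ) {θ₁ θ₂ : ℝ} (hθ : (θ₁, θ₂) ∈ ThetaSet μ β β' X)
    (hp : Integrable (pFam ψ X θ₁ θ₂) μ) (hXp : Integrable (fun r => X r * pFam ψ X θ₁ θ₂ r) μ)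
    {ϑ : ℝ × ℝ} (hϑ : ϑ ∈ domK μ β X) :
    (ϑ.1 - θ₁) * ∫ r, pFam ψ X θ₁ θ₂ r ∂μ + (ϑ.2 - θ₂) * ∫ r, X r * pFam ψ X θ₁ θ₂ r ∂μ ≤
        Kreal μ β X ϑ - Kreal μ β X (θ₁, θ₂) ∧
      Tendsto (fun n : ℕ => ((n : ℝ) + 1) *
        (Kreal μ β X ((θ₁, θ₂) + (1 / ((n : ℝ) + 1)) • (ϑ - (θ₁, θ₂))) - Kreal μ β X (θ₁, θ₂)))
        atTop (𝓝 ((ϑ.1 - θ₁) * ∫ r, pFam ψ X θ₁ θ₂ r ∂μ +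
          (ϑ.2 - θ₂) * ∫ r, X r * pFam ψ X θ₁ θ₂ r ∂μ)) := by
  obtain ⟨hf, hi⟩ := (mem_domK_iff hst _).1 hθ.1
  obtain ⟨hf', hi'⟩ := (mem_domK_iff hst _).1 hϑ
  have hmem : ∀ n : ℕ, (θ₁, θ₂) + (1 / ((n : ℝ) + 1)) • (ϑ - (θ₁, θ₂)) ∈ domK μ β X := fun n => by
    refine (convex_domK hst).add_smul_sub_mem hθ.1 hϑ ⟨by positivity, ?_⟩
    rw [div_le_one (by positivity)]
    linarith [n.cast_nonneg (α := ℝ)]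
  set δ : Ω → ℝ := fun r => (ϑ.1 - θ₁) + (ϑ.2 - θ₂) * X r with hδ
  have hend : ∀ r, θ₁ + θ₂ * X r + δ r = ϑ.1 + ϑ.2 * X r := fun r => by
    simp only [hδ]
    ring
  have hpδ : Integrable (fun r => pFam ψ X θ₁ θ₂ r * δ r) μ := by
    refine ((hp.const_mul (ϑ.1 - θ₁)).add (hXp.const_mul (ϑ.2 - θ₂))).congr
      (ae_of_all _ fun r => ?_)
    simp only [hδ, Pi.add_apply]
    ring
  have hint : ∫ r, pFam ψ X θ₁ θ₂ r * δ r ∂μ = (ϑ.1 - θ₁) * ∫ r, pFam ψ X θ₁ θ₂ r ∂μ +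
      (ϑ.2 - θ₂) * ∫ r, X r * pFam ψ X θ₁ θ₂ r ∂μ := by
    rw [← integral_const_mul, ← integral_const_mul,
      ← integral_add (hp.const_mul _) (hXp.const_mul _)]
    refine integral_congr_ae (ae_of_all _ fun r => ?_)
    simp only [hδ]
    ring
  rw [← hint]
  have hsub : ∀ᵐ r ∂μ, pFam ψ X θ₁ θ₂ r * δ r ≤
      (conjβ β r (ϑ.1 + ϑ.2 * X r)).toReal - (conjβ β r (θ₁ + θ₂ * X r)).toReal := by
    filter_upwards [ae_hasDerivAt_pFam hψ hθ, hf, hf'] with r hr h1 h2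
    rw [← hend] at h2 ⊢
    exact deriv_mul_le_conjβ_sub hst hr h1 h2
  refine ⟨?_, ?_⟩
  · have := integral_mono_ae hpδ (hi'.sub hi) hsub
    rwa [integral_sub' hi' hi] at this
  set F : ℕ → Ω → ℝ := fun n r => ((n : ℝ) + 1) *
    ((conjβ β r (θ₁ + θ₂ * X r + 1 / ((n : ℝ) + 1) * δ r)).toReal -
      (conjβ β r (θ₁ + θ₂ * X r)).toReal) with hF
  have hpt : ∀ (n : ℕ) r, ((θ₁, θ₂) + (1 / ((n : ℝ) + 1)) • (ϑ - (θ₁, θ₂))).1 +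
      ((θ₁, θ₂) + (1 / ((n : ℝ) + 1)) • (ϑ - (θ₁, θ₂))).2 * X r =
        θ₁ + θ₂ * X r + 1 / ((n : ℝ) + 1) * δ r := fun n r => by
    simp only [hδ, Prod.fst_add, Prod.snd_add, Prod.smul_fst, Prod.smul_snd, Prod.fst_sub,
      Prod.snd_sub, smul_eq_mul]
    ring
  have hdomn : ∀ n : ℕ,
      (∀ᵐ r ∂μ, conjβ β r (θ₁ + θ₂ * X r + 1 / ((n : ℝ) + 1) * δ r) ≠ ⊤) ∧
        Integrable (fun r => (conjβ β r (θ₁ + θ₂ * X r + 1 / ((n : ℝ) + 1) * δ r)).toReal) μ :=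
    fun n => by simpa only [hpt] using (mem_domK_iff hst _).1 (hmem n)
  have hlim := tendsto_integral_of_dominated_convergence (μ := μ) (F := F)
    (f := fun r => pFam ψ X θ₁ θ₂ r * δ r)
    (fun r => |pFam ψ X θ₁ θ₂ r * δ r| +
      |(conjβ β r (ϑ.1 + ϑ.2 * X r)).toReal - (conjβ β r (θ₁ + θ₂ * X r)).toReal|)
    (fun n => (((hdomn n).2.sub hi).const_mul _).aestronglyMeasurable)
    (hpδ.abs.add (hi'.sub hi).abs)
    (fun n => ?_) ?_
  · refine hlim.congr fun n => ?_
    simp only [hF, Kreal, hpt]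
    rw [integral_const_mul, integral_sub (hdomn n).2 hi]
  · filter_upwards [ae_hasDerivAt_pFam hψ hθ, hf, hf', (hdomn n).1] with r hr h1 h2 h3
    have hn : (0 : ℝ) < n + 1 := by positivity
    rw [← hend] at h2 ⊢
    have hup := slope_conjβ_le hst h1 h2 n
    have hlow := mul_le_mul_of_nonneg_left (deriv_mul_le_conjβ_sub hst hr h1 h3) hn.le
    rw [show ((n : ℝ) + 1) * (pFam ψ X θ₁ θ₂ r * (1 / ((n : ℝ) + 1) * δ r)) =
      pFam ψ X θ₁ θ₂ r * δ r by field_simp] at hlow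
    simp only [hF, Real.norm_eq_abs]
    refine abs_le.2 ⟨?_, ?_⟩
    · linarith [neg_abs_le (pFam ψ X θ₁ θ₂ r * δ r), abs_nonneg
        ((conjβ β r (θ₁ + θ₂ * X r + δ r)).toReal - (conjβ β r (θ₁ + θ₂ * X r)).toReal)]
    · linarith [abs_nonneg (pFam ψ X θ₁ θ₂ r * δ r), le_abs_self
        ((conjβ β r (θ₁ + θ₂ * X r + δ r)).toReal - (conjβ β r (θ₁ + θ₂ * X r)).toReal)]
  · filter_upwards [ae_hasDerivAt_pFam hψ hθ] with r hr
    exact hr.tendsto_nat_slope (δ r)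

theorem dual_objective_eq (hst : Standing μ β β' X p₀ b₀) {θ : ℝ × ℝ} (hθ : θ ∈ domK μ β X)
    (k : ℝ) : ((k : EReal) + Kfun μ β X θ.1 θ.2 - (θ.1 : EReal)) / (θ.2 : EReal) =
      (((k + Kreal μ β X θ - θ.1) / θ.2 : ℝ) : EReal) := by
  rw [Kfun_eq_Kreal hst hθ]
  norm_cast

/-- The dual maximum `V(k)` is attained exactly at the minimisers of the dual functional. -/
theorem isWCLParam_iff (hst : Standing μ β β' X p₀ b₀) {k b : ℝ} (hk : 0 < k)
    (hkmax : (k : EReal) < kmax μ β X b₀) (hb : Vfun μ β X k = (b : EReal)) {θ : ℝ × ℝ}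
    (hθ : θ ∈ domK μ β X) (hθ₂ : θ.2 < 0) :
    IsWCLParam μ β X k θ.1 θ.2 ↔ Kreal μ β X θ ≤ θ.1 + θ.2 * b - k := by
  constructor
  · rintro ⟨-, hmax⟩
    obtain ⟨ϑ, hϑ₂, hϑ, hle⟩ := exists_Kreal_le hst hθ hk hkmax hb
    have h := hmax ϑ.1 ϑ.2 hϑ₂
    rw [dual_objective_eq hst hϑ, dual_objective_eq hst hθ, EReal.coe_le_coe_iff] at h
    have h1 : b ≤ (k + Kreal μ β X ϑ - ϑ.1) / ϑ.2 := by
      rw [le_div_iff_of_neg hϑ₂]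
      linarith
    have h2 := (le_div_iff_of_neg hθ₂).1 (h1.trans h)
    linarith
  · refine fun hle => ⟨hθ₂, fun θ₁' θ₂' hθ' => ?_⟩
    by_cases hdom : (θ₁', θ₂') ∈ domK μ β X
    · rw [dual_objective_eq hst hdom, dual_objective_eq hst hθ, EReal.coe_le_coe_iff]
      have hweak := le_Kreal_of_Vfun_eq hst hb hdom
      simp only at hweak
      have h1 : (k + Kreal μ β X (θ₁', θ₂') - θ₁') / θ₂' ≤ b := by
        rw [div_le_iff_of_neg hθ']
        linarith
      refine h1.trans ?_
      rw [le_div_iff_of_neg hθ₂]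
      linarith
    · have htop : Kfun μ β X θ₁' θ₂' = ⊤ := not_lt_top_iff.1 hdom
      rw [htop, EReal.coe_add_top, EReal.top_sub_coe,
        EReal.top_div_of_neg_ne_bot (by exact_mod_cast hθ') (EReal.coe_ne_bot _)]
      exact bot_le

end NormalCone

/-- Lemma on the normal cone. A function `p_{θ₁,θ₂}`, with
`(θ₁,θ₂) ∈ Θ`, `θ₂ < 0`, is the worst case localiser `q̂_k` for `k ∈ (0, k_max)` iff
the vector `(1 − ∫ p_{θ₁,θ₂} dμ, V(k) − ∫ X p_{θ₁,θ₂} dμ)` belongs to the normal cone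
of `dom K` at `(θ₁,θ₂)`; here `a = ∫ p_{θ₁,θ₂} dμ`, `c = ∫ X p_{θ₁,θ₂} dμ` and
`b = V(k)`. -/
theorem normal_cone_characterisation {Ω : Type*} [MeasurableSpace Ω] (μ : Measure Ω)
    (β : Ω → ℝ → EReal) (β' : Ω → ℝ → ℝ) (ψ : Ω → ℝ → ℝ) (X : Ω → ℝ) (p₀ : Ω → ℝ) (b₀ : ℝ)
    (hst : Standing μ β β' X p₀ b₀) (hψ : IsConjDeriv β β' ψ)
    (k : ℝ) (hk0 : 0 < k) (hkmax : (k : EReal) < kmax μ β X b₀)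
    (θ₁ θ₂ : ℝ) (hθ : (θ₁, θ₂) ∈ ThetaSet μ β β' X) (hθ₂ : θ₂ < 0)
    (b : ℝ) (hb : Vfun μ β X k = (b : EReal))
    (a : ℝ) (ha : pInt μ (pFam ψ X θ₁ θ₂) = ENNReal.ofReal a) (ha0 : 0 ≤ a)
    (c : ℝ) (hc : xInt μ X (pFam ψ X θ₁ θ₂) = (c : EReal)) :
    IsWCLParam μ β X k θ₁ θ₂ ↔
      ∀ θb : ℝ × ℝ, θb ∈ domK μ β X →
        (θb.1 - θ₁) * (1 - a) + (θb.2 - θ₂) * (b - c) ≤ 0 := by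
  obtain ⟨hp, hpa⟩ := integrable_pFam hst hψ hθ ha ha0
  obtain ⟨hXp, hXc⟩ := integrable_of_xInt_eq_coe hst.Xmeas (aemeasurable_pFam hst hψ hθ) hc
  have hslope := fun ϑ : ℝ × ℝ => tendsto_slope_Kreal hst hψ hθ hp hXp (ϑ := ϑ)
  rw [hpa, hXc] at hslope
  rw [isWCLParam_iff hst hk0 hkmax hb hθ.1 hθ₂]
  constructor
  · intro hle θb hθb
    have hge := ge_of_tendsto' (hslope θb hθb).2
      (b := (θb.1 - θ₁) + (θb.2 - θ₂) * b) fun n => ?_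
    · linarith
    have hn : (0 : ℝ) < n + 1 := by positivity
    have hmem : (θ₁, θ₂) + (1 / ((n : ℝ) + 1)) • (θb - (θ₁, θ₂)) ∈ domK μ β X := by
      refine (convex_domK hst).add_smul_sub_mem hθ.1 hθb ⟨by positivity, ?_⟩
      rw [div_le_one hn]
      linarith [n.cast_nonneg (α := ℝ)]
    have hweak := le_Kreal_of_Vfun_eq hst hb hmem
    simp only [Prod.fst_add, Prod.snd_add, Prod.smul_fst, Prod.smul_snd, Prod.fst_sub,
      Prod.snd_sub, smul_eq_mul] at hweak hle
    rw [← div_le_iff₀' hn]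
    refine le_trans (le_of_eq ?_) (sub_le_sub hweak hle)
    field_simp
    ring
  · intro hcone
    obtain ⟨ϑ, -, hϑ, hle⟩ := exists_Kreal_le hst hθ.1 hk0 hkmax hb
    have h1 := (hslope ϑ hϑ).1
    have h2 := hcone ϑ hϑ
    simp only
    linarith
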